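/- arXiv:2004.14926 — 2 statements merged into one kernel-verified Lean document; each statement's English description precedes it below -/
import Mathlib

section
/- The intersection of the bifurcation set with [g,1] equals 𝓔̃, i.e., 𝓔 ∩ [g,1] = {α ∈ [g,1] : T_α^n(α−1) ≤ 1/(α+1) and T_α^n(1/α − 1) ≤ 1/(α+1) for all n ≥ 1}. -/
open Set Filter MeasureTheory

/-- The Tanaka–Ito `α`-continued fraction map. -/
noncomputable def T (α x : ℝ) : ℝ := if x = 0 then 0 else 1 / x - (⌊1 / x + 1 - α⌋ : ℝ)

/-- The small golden mean `g = (√5 - 1)/2`. -/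
noncomputable def g : ℝ := (Real.sqrt 5 - 1) / 2

/-- `J` is a matching interval with matching exponents `(M, N)`. -/
def IsMatchingInterval (J : Set ℝ) (M N : ℕ) : Prop :=
  (∃ a b : ℝ, a < b ∧ J = Set.Ioo a b) ∧ J ⊆ Set.Icc 0 1 ∧
  (∀ α ∈ J, (T α)^[M] (α - 1) = (T α)^[N] α) ∧
  (∀ᵐ α ∂(volume.restrict J), (T α)^[M - 1] (α - 1) ≠ (T α)^[N - 1] α) ∧
  (∀ J' : Set ℝ, (∃ a b : ℝ, a < b ∧ J' = Set.Ioo a b) → J' ⊆ Set.Icc 0 1 →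
    (∀ α ∈ J', (T α)^[M] (α - 1) = (T α)^[N] α) →
    (∀ᵐ α ∂(volume.restrict J'), (T α)^[M - 1] (α - 1) ≠ (T α)^[N - 1] α) →
    J ⊆ J' → J' = J)

/-- The matching set: the union of all matching intervals. -/
def MatchingSet : Set ℝ := {x | ∃ (J : Set ℝ) (M N : ℕ), IsMatchingInterval J M N ∧ x ∈ J}

/-- The bifurcation set `𝓔`: the complement in `[0,1]` of the matching set. -/
def E : Set ℝ := Set.Icc 0 1 \ MatchingSet

/-- The set `𝓔̃` of parameters in `[g,1]` whose orbits stay below `1/(α+1)`. -/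
noncomputable def Etilde : Set ℝ :=
  {α ∈ Set.Icc g 1 | ∀ n ≥ 1,
    (T α)^[n] (α - 1) ≤ 1 / (α + 1) ∧ (T α)^[n] (1 / α - 1) ≤ 1 / (α + 1)}

namespace TanakaIto

lemma g_sq : g * g + g = 1 := by
  have h : √5 * √5 = 5 := Real.mul_self_sqrt (by norm_num)
  unfold g
  linarith

lemma g_gt : 3 / 5 < g := by
  have h : (2.2 : ℝ) < √5 := Real.lt_sqrt_of_sq_lt (by norm_num)
  unfold g
  linarith

lemma g_lt : g < 2 / 3 := by
  nlinarith [g_sq, g_gt]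

lemma one_lt_of_g_lt {α : ℝ} (hα : g < α) : 1 < α * α + α := by
  nlinarith [g_sq, g_gt]

lemma T_zero (α : ℝ) : T α 0 = 0 := if_pos rfl

lemma T_of_ne {α x : ℝ} (hx : x ≠ 0) : T α x = 1 / x - (⌊1 / x + 1 - α⌋ : ℝ) := if_neg hx

lemma T_mem {α : ℝ} (h0 : 0 < α) (h1 : α ≤ 1) (x : ℝ) : T α x ∈ Ico (α - 1) α := by
  rcases eq_or_ne x 0 with rfl | hx
  · rw [T_zero]; exact ⟨by linarith, h0⟩
  · rw [T_of_ne hx]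
    have h2 := Int.floor_le (1 / x + 1 - α)
    have h3 := Int.lt_floor_add_one (1 / x + 1 - α)
    exact ⟨by linarith, by linarith⟩

lemma T_eq_of_mem {α x : ℝ} (hx : x ≠ 0) (d : ℤ) (h : 1 / x - d ∈ Ico (α - 1) α) :
    T α x = 1 / x - d := by
  rw [T_of_ne hx]
  have : ⌊1 / x + 1 - α⌋ = d := by
    rw [Int.floor_eq_iff]
    exact ⟨by linarith [h.1], by linarith [h.2]⟩
  rw [this]

lemma T_eq_T {α x y : ℝ} (hx : x ≠ 0) (hy : y ≠ 0) (k : ℤ) (h : 1 / x = 1 / y + k) :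
    T α x = T α y := by
  rw [T_of_ne hx, T_of_ne hy, h, show 1 / y + (k : ℝ) + 1 - α = 1 / y + 1 - α + k by ring,
    Int.floor_add_intCast]
  push_cast
  ring

/-- The relations that tie the orbits of `α - 1` and `1 / α - 1` together before matching. -/
def Linked (x y : ℝ) : Prop := (1 + x) * (1 + y) = 1 ∨ x + y = 0 ∨ x + y = 1

lemma Linked.symm {x y : ℝ} (h : Linked x y) : Linked y x := by
  rcases h with h | h | h
  · exact Or.inl (by linarith)
  · exact Or.inr (Or.inl (by linarith))
  · exact Or.inr (Or.inr (by linarith))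

lemma T_add_T {α x y : ℝ} (hα : α ∈ Ioo g 1) (hx : x ≠ 0) (hy : y ≠ 0) (k : ℤ)
    (h : 1 / x + 1 / y = k) : T α x + T α y = 0 ∨ T α x + T α y = 1 := by
  have hg := g_gt
  have h1 := T_mem (by linarith [hα.1]) hα.2.le x
  have h2 := T_mem (by linarith [hα.1]) hα.2.le y
  have h3 : T α x + T α y = ((k - ⌊1 / x + 1 - α⌋ - ⌊1 / y + 1 - α⌋ : ℤ) : ℝ) := by
    rw [T_of_ne hx, T_of_ne hy]
    push_cast
    linarith
  obtain ⟨m, hm⟩ : ∃ m : ℤ, T α x + T α y = (m : ℝ) := ⟨_, h3⟩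
  have h4 : (-1 : ℝ) < m := by rw [← hm]; linarith [h1.1, h2.1, hα.1]
  have h5 : (m : ℝ) < 2 := by rw [← hm]; linarith [h1.2, h2.2, hα.2]
  have h6 : -1 < m := by exact_mod_cast h4
  have h7 : m < 2 := by exact_mod_cast h5
  interval_cases m
  · left; simpa using hm
  · right; simpa using hm

lemma Linked.eq_zero {α x y : ℝ} (hα : α ∈ Ioo g 1) (hy : y ∈ Ico (α - 1) α)
    (h : Linked x y) (hx : x = 0) : y = 0 := by
  subst hx
  rcases h with h | h | h
  · linarith
  · linarith
  · linarith [hy.2, hα.2]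

lemma T_of_gt {α x : ℝ} (hα : α ∈ Ioo g 1) (hx : x ∈ Ico (α - 1) α) (h : 1 / (α + 1) < x) :
    T α x = 1 / x - 1 := by
  have hg := g_gt
  have ha : 0 < α + 1 := by linarith [hα.1]
  have hx0 : 0 < x := lt_trans (by positivity) h
  have h1 : 1 < x * (α + 1) := by rwa [div_lt_iff₀ ha] at h
  have := T_eq_of_mem (α := α) hx0.ne' 1 ⟨?_, ?_⟩
  · simpa using this
  · have : 1 < 1 / x := by rw [lt_div_iff₀ hx0]; linarith [hx.2, hα.2]
    push_cast; linarith [hα.2]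
  · have : 1 / x < α + 1 := by rw [div_lt_iff₀ hx0]; linarith
    push_cast; linarith

lemma T_eq_of_eq {α x : ℝ} (hα : α ∈ Ioo g 1) (h : x = 1 / (α + 1)) : T α x = α - 1 := by
  have hg := g_gt
  have ha : 0 < α + 1 := by linarith [hα.1]
  have h1 : 1 / x = α + 1 := by rw [h, one_div_one_div]
  have hx0 : x ≠ 0 := by rw [h]; positivity
  have := T_eq_of_mem (α := α) hx0 2 ⟨?_, ?_⟩
  · rw [this, h1]; push_cast; ring
  · rw [h1]; push_cast; linarith
  · rw [h1]; push_cast; linarith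

lemma T_of_mid {α x : ℝ} (hα : α ∈ Ioo g 1) (h : x ≤ 1 / (α + 1)) (h' : 1 - 1 / (α + 1) ≤ x) :
    T α x = 1 / x - 2 := by
  have hg := g_gt
  have ha : 0 < α + 1 := by linarith [hα.1]
  have ha' : 0 < α := by linarith [hα.1]
  have h2 : 1 - 1 / (α + 1) = α / (α + 1) := by field_simp; ring
  rw [h2, div_le_iff₀ ha] at h'
  rw [le_div_iff₀ ha] at h
  have hx0 : 0 < x := by nlinarith
  have := T_eq_of_mem (α := α) hx0.ne' 2 ⟨?_, ?_⟩
  · simpa using this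
  · have : α + 1 ≤ 1 / x := by rw [le_div_iff₀ hx0]; linarith
    push_cast; linarith
  · have : 1 / x < α + 2 := by
      rw [div_lt_iff₀ hx0]
      nlinarith [one_lt_of_g_lt hα.1]
    push_cast; linarith

lemma Linked.map {α x y : ℝ} (hα : α ∈ Ioo g 1) (hx : x ∈ Ico (α - 1) α)
    (hy : y ∈ Ico (α - 1) α) (h : Linked x y) (hx' : x ≤ 1 / (α + 1)) (hy' : y ≤ 1 / (α + 1)) :
    Linked (T α x) (T α y) := by
  rcases eq_or_ne x 0 with rfl | hx0
  · rw [h.eq_zero hα hy rfl, T_zero]; right; left; simp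
  have hy0 : y ≠ 0 := fun h0 => hx0 (h.symm.eq_zero hα hx h0)
  rcases h with h | h | h
  · right
    refine T_add_T hα hx0 hy0 (-1) ?_
    field_simp; push_cast; linarith
  · right
    refine T_add_T hα hx0 hy0 0 ?_
    field_simp; push_cast; linarith
  · left
    rw [T_of_mid hα hx' (by linarith), T_of_mid hα hy' (by linarith)]
    obtain rfl : y = 1 - x := by linarith
    field_simp
    ring

lemma Linked.eq_one_of_gt {α x y : ℝ} (hα : α ∈ Ioo g 1) (hx : x ∈ Ico (α - 1) α)
    (h : Linked x y) (hy' : 1 / (α + 1) < y) : x + y = 1 := by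
  have hg := g_gt
  have ha : 0 < α + 1 := by linarith [hα.1]
  have h1 := one_lt_of_g_lt hα.1
  rw [div_lt_iff₀ ha] at hy'
  have hxa := hx.1
  have hy0 : 0 < y := by nlinarith
  rcases h with h | h | h
  · exfalso
    have h2 : α * (1 + y) ≤ 1 := by nlinarith
    nlinarith [hα.1]
  · exfalso
    nlinarith [hα.1]
  · exact h

lemma Linked.matching_of_gt {α x y : ℝ} (hα : α ∈ Ioo g 1) (hx : x ∈ Ico (α - 1) α)
    (hy : y ∈ Ico (α - 1) α) (h : Linked x y) (hy' : 1 / (α + 1) < y) :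
    T α (T α y) = T α x ∧ T α y ≠ x := by
  have hg := g_gt
  have ha : 0 < α + 1 := by linarith [hα.1]
  have h1 := h.eq_one_of_gt hα hx hy'
  have hy0 : 0 < y := lt_trans (by positivity) hy'
  have hx0 : 0 < x := by linarith [hy.2, hα.2]
  obtain rfl : y = 1 - x := by linarith
  have h2 : 1 / (1 - x) - 1 = x / (1 - x) := by field_simp; ring
  rw [T_of_gt hα hy hy', h2]
  constructor
  · refine T_eq_T (by positivity) hx0.ne' (-1) ?_
    field_simp
    push_cast
    ring
  · rw [Ne, div_eq_iff hy0.ne']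
    nlinarith

/-- The two critical orbits: that of `α - 1` (`true`) and that of `1 / α - 1` (`false`). -/
noncomputable def orb (b : Bool) (n : ℕ) (α : ℝ) : ℝ :=
  (T α)^[n] (cond b (α - 1) (1 / α - 1))

lemma orb_succ (b : Bool) (n : ℕ) (α : ℝ) : orb b (n + 1) α = T α (orb b n α) :=
  Function.iterate_succ_apply' _ _ _

lemma orb_add (b : Bool) (m n : ℕ) (α : ℝ) : orb b (n + m) α = (T α)^[n] (orb b m α) :=
  Function.iterate_add_apply _ _ _ _

lemma orb_true_zero (α : ℝ) : orb true 0 α = α - 1 := rfl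

lemma orb_false_zero (α : ℝ) : orb false 0 α = 1 / α - 1 := rfl

lemma inv_sub_one_mem {α : ℝ} (hα : α ∈ Ioo g 1) : 1 / α - 1 ∈ Ioo 0 α := by
  have hg := g_gt
  have h0 : 0 < α := by linarith [hα.1]
  have h1 := one_lt_of_g_lt hα.1
  have h2 : 1 < 1 / α := by rw [lt_div_iff₀ h0]; linarith [hα.2]
  have h3 : 1 / α < α + 1 := by rw [div_lt_iff₀ h0]; linarith
  exact ⟨by linarith, by linarith⟩

lemma orb_mem {α : ℝ} (hα : α ∈ Ioo g 1) (b : Bool) (n : ℕ) : orb b n α ∈ Ico (α - 1) α := by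
  have hg := g_gt
  cases n with
  | zero =>
    cases b
    · have := inv_sub_one_mem hα
      exact ⟨by rw [orb_false_zero]; linarith [this.1, hα.2], this.2⟩
    · exact ⟨le_rfl, by rw [orb_true_zero]; linarith⟩
  | succ n => rw [orb_succ]; exact T_mem (by linarith [hα.1]) hα.2.le _

/-- One of the two critical orbits is beyond `1 / (α + 1)` at time `n`. -/
def Exits (α : ℝ) (n : ℕ) : Prop := ∃ b, 1 / (α + 1) < orb b n α

/-- The time `n` is the first at which one of the critical orbits is beyond `1 / (α + 1)`. -/
def FirstExit (α : ℝ) (n : ℕ) : Prop := Exits α n ∧ ∀ i < n, ¬ Exits α i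

lemma le_of_not_exits {α : ℝ} {n : ℕ} (h : ¬ Exits α n) (b : Bool) : orb b n α ≤ 1 / (α + 1) :=
  not_lt.1 fun h' => h ⟨b, h'⟩

lemma bounds {α : ℝ} (hα : α ∈ Ioo g 1) :
    α - 1 < 1 / (α + 1) ∧ 1 - α < 1 / (α + 1) ∧ 1 / α - 1 < 1 / (α + 1) ∧ 1 / (α + 1) < α := by
  have hg := g_gt
  have h0 : 0 < α := by linarith [hα.1]
  have h1 := one_lt_of_g_lt hα.1
  have h2 := hα.2
  refine ⟨?_, ?_, ?_, ?_⟩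
  · rw [lt_div_iff₀ (by linarith)]; nlinarith
  · rw [lt_div_iff₀ (by linarith)]; nlinarith
  · rw [lt_div_iff₀ (by linarith), sub_mul, div_mul_eq_mul_div, sub_lt_iff_lt_add,
      div_lt_iff₀ h0]
    nlinarith
  · rw [div_lt_iff₀ (by linarith)]; nlinarith

lemma not_exits_zero {α : ℝ} (hα : α ∈ Ioo g 1) : ¬ Exits α 0 := by
  obtain ⟨h1, -, h2, -⟩ := bounds hα
  rintro ⟨b, hb⟩
  cases b
  · rw [orb_false_zero] at hb; linarith
  · rw [orb_true_zero] at hb; linarith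

lemma linked_orb {α : ℝ} (hα : α ∈ Ioo g 1) (b : Bool) {n : ℕ} (h : ∀ i < n, ¬ Exits α i) :
    Linked (orb b n α) (orb (!b) n α) := by
  induction n with
  | zero =>
    have h0 : α ≠ 0 := by have := g_gt; linarith [hα.1]
    have : Linked (orb true 0 α) (orb false 0 α) := by
      left
      rw [orb_true_zero, orb_false_zero]
      field_simp
      ring
    cases b
    · exact this.symm
    · exact this
  | succ n ih =>
    rw [orb_succ, orb_succ]
    have hn := h n n.lt_succ_self
    exact (ih fun i hi => h i (by omega)).map hα (orb_mem hα _ _) (orb_mem hα _ _)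
      (le_of_not_exits hn _) (le_of_not_exits hn _)

lemma FirstExit.matching {α : ℝ} (hα : α ∈ Ioo g 1) {n : ℕ} (h : ∀ i < n, ¬ Exits α i) {b : Bool}
    (hb : 1 / (α + 1) < orb b n α) :
    orb b (n + 2) α = orb (!b) (n + 1) α ∧ orb b (n + 1) α ≠ orb (!b) n α := by
  rw [orb_succ, orb_succ, orb_succ]
  exact (linked_orb hα b h).symm.matching_of_gt hα (orb_mem hα _ _) (orb_mem hα _ _) hb

/-- If an orbit of a linked pair returns to `α - 1`, the other one is at `1 / α - 1` or
`1 - α`. -/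
lemma Linked.of_eq {α x y : ℝ} (hα : α ∈ Ioo g 1) (hy : y ∈ Ico (α - 1) α) (h : Linked x y)
    (hx : x = α - 1) : y = 1 / α - 1 ∨ y = 1 - α := by
  have hg := g_gt
  have h0 : 0 < α := by linarith [hα.1]
  subst hx
  rcases h with h | h | h
  · left; field_simp; linarith
  · right; linarith
  · linarith [hy.2, hα.2]

lemma orb_true {α : ℝ} (n : ℕ) : orb true n α = (T α)^[n] (α - 1) := rfl

lemma T_self {α : ℝ} (hα : α ∈ Ioo g 1) : T α α = 1 / α - 1 := by
  have hg := g_gt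
  have h := inv_sub_one_mem hα
  have := T_eq_of_mem (α := α) (x := α) (by linarith [hα.1]) 1
    ⟨by push_cast; linarith [h.1, hα.2], by push_cast; exact h.2⟩
  simpa using this

lemma orb_false {α : ℝ} (hα : α ∈ Ioo g 1) (n : ℕ) : orb false n α = (T α)^[n + 1] α := by
  rw [Function.iterate_succ_apply, T_self hα]
  rfl

lemma quadratic_coeff_eq_zero {x : ℝ} (hx : Transcendental ℤ x) (a b c : ℤ)
    (h : a * x ^ 2 + b * x + c = 0) : a = 0 ∧ b = 0 ∧ c = 0 := by
  have h1 := transcendental_iff.1 hx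
    (Polynomial.C a * Polynomial.X ^ 2 + Polynomial.C b * Polynomial.X + Polynomial.C c)
    (by simpa using h)
  refine ⟨?_, ?_, ?_⟩
  · simpa [Polynomial.coeff_C, Polynomial.coeff_X, -eq_intCast] using
      congrArg (fun p => Polynomial.coeff p 2) h1
  · simpa [Polynomial.coeff_C, Polynomial.coeff_X, -eq_intCast] using
      congrArg (fun p => Polynomial.coeff p 1) h1
  · simpa [Polynomial.coeff_C, Polynomial.coeff_X, -eq_intCast] using
      congrArg (fun p => Polynomial.coeff p 0) h1

lemma ne_zero_of_transcendental {x : ℝ} (hx : Transcendental ℤ x) : x ≠ 0 := by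
  rintro rfl
  exact hx isAlgebraic_zero

lemma transcendental_one_div_sub {x : ℝ} (hx : Transcendental ℤ x) (d : ℤ) :
    Transcendental ℤ (1 / x - d) := by
  intro h
  have h1 : IsAlgebraic ℤ (1 / x) := by
    simpa using h.add (isAlgebraic_algebraMap (R := ℤ) (A := ℝ) d)
  rw [one_div] at h1
  exact hx (IsAlgebraic.inv_iff.1 h1)

lemma transcendental_T {α x : ℝ} (hx : Transcendental ℤ x) : Transcendental ℤ (T α x) := by
  rw [T_of_ne (ne_zero_of_transcendental hx)]
  exact transcendental_one_div_sub hx _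

lemma transcendental_iterate {α x : ℝ} (hx : Transcendental ℤ x) (n : ℕ) :
    Transcendental ℤ ((T α)^[n] x) := by
  induction n with
  | zero => exact hx
  | succ n ih => rw [Function.iterate_succ_apply']; exact transcendental_T ih

lemma transcendental_orb {α : ℝ} (hα : Transcendental ℤ α) (b : Bool) (n : ℕ) :
    Transcendental ℤ (orb b n α) := by
  refine transcendental_iterate ?_ n
  cases b
  · simpa using transcendental_one_div_sub hα 1
  · intro h
    exact hα (by simpa using h.add isAlgebraic_one)

lemma iterate_eq_div {α x : ℝ} (hα : α ∈ Ioo g 1) (hx : Transcendental ℤ x) (k : ℕ) :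
    ∃ a b c d : ℤ, (c * x + d : ℝ) ≠ 0 ∧ (T α)^[k] x * (c * x + d) = a * x + b ∧
      |(T α)^[k] x * (c * x + d)| ≤ |x| ∧ (1 ≤ k → |(c * x + d : ℝ)| ≤ |x|) := by
  have hg := g_gt
  induction k with
  | zero => exact ⟨1, 0, 0, 1, by simp, by simp, by simp, by simp⟩
  | succ k ih =>
    obtain ⟨a, b, c, d, h0, h1, h2, -⟩ := ih
    set y := (T α)^[k] x with hy
    have hy0 : y ≠ 0 := ne_zero_of_transcendental (transcendental_iterate hx k)
    have hT := T_of_ne (α := α) hy0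
    have hm := T_mem (by linarith [hα.1]) hα.2.le y
    rw [Function.iterate_succ_apply', ← hy]
    refine ⟨c - ⌊1 / y + 1 - α⌋ * a, d - ⌊1 / y + 1 - α⌋ * b, a, b, ?_, ?_, ?_, fun _ => ?_⟩
    · rw [← h1]; exact mul_ne_zero hy0 h0
    · rw [← h1, hT, sub_mul, one_div_mul_eq_div, mul_div_cancel_left₀ _ hy0, h1]
      push_cast
      ring
    · rw [← h1, abs_mul]
      refine le_trans (mul_le_of_le_one_left (abs_nonneg _) ?_) h2
      rw [abs_le]
      exact ⟨by linarith [hm.1, hα.1], by linarith [hm.2, hα.2]⟩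
    · rwa [← h1]

lemma int_eq_zero_of_abs_le {x : ℝ} (hx : |x| < 1) {d : ℤ} (h : |(d : ℝ)| ≤ |x|) : d = 0 := by
  have h1 : |(d : ℝ)| < 1 := lt_of_le_of_lt h hx
  exact Int.abs_lt_one_iff.1 (by exact_mod_cast h1)

lemma iterate_ne_self {α x : ℝ} (hα : α ∈ Ioo g 1) (hx : Transcendental ℤ x)
    (hxm : x ∈ Ico (α - 1) α) {k : ℕ} (hk : 1 ≤ k) : (T α)^[k] x ≠ x := by
  intro h
  have hg := g_gt
  have hx1 : |x| < 1 := abs_lt.2 ⟨by linarith [hxm.1, hα.1], by linarith [hxm.2, hα.2]⟩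
  obtain ⟨a, b, c, d, h0, h1, -, h2⟩ := iterate_eq_div hα hx k
  rw [h] at h1
  obtain ⟨rfl, -, -⟩ := quadratic_coeff_eq_zero hx c (d - a) (-b) (by push_cast; linarith)
  simp only [Int.cast_zero, zero_mul, zero_add] at h0 h2
  exact h0 (by rw [int_eq_zero_of_abs_le hx1 (h2 hk), Int.cast_zero])

lemma Linked.iterate_ne {α x z : ℝ} (hα : α ∈ Ioo g 1) (hx : Transcendental ℤ x)
    (hxm : x ∈ Ico (α - 1) α) (hz : Linked z x) (k : ℕ) : (T α)^[k] x ≠ z := by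
  intro h
  have hg := g_gt
  have hx1 : |x| < 1 := abs_lt.2 ⟨by linarith [hxm.1, hα.1], by linarith [hxm.2, hα.2]⟩
  obtain rfl | hk := Nat.eq_zero_or_pos k
  · obtain rfl : x = z := h
    rcases hz with hz | hz | hz
    · have := quadratic_coeff_eq_zero hx 1 2 0 (by push_cast; linarith)
      omega
    · have := quadratic_coeff_eq_zero hx 0 2 0 (by push_cast; linarith)
      omega
    · have := quadratic_coeff_eq_zero hx 0 2 (-1) (by push_cast; linarith)
      omega
  obtain ⟨a, b, c, d, h0, h1, -, h2⟩ := iterate_eq_div hα hx k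
  specialize h2 hk
  rw [h] at h1
  have key : c = 0 → False := by
    rintro rfl
    simp only [Int.cast_zero, zero_mul, zero_add] at h0 h2
    exact h0 (by rw [int_eq_zero_of_abs_le hx1 h2, Int.cast_zero])
  rcases hz with hz | hz | hz
  · have h3 : (1 + x) * (a * x + b) = -x * (c * x + d) := by
      rw [← h1]; linear_combination (c * x + d) * hz
    obtain ⟨h4, h5, h6⟩ := quadratic_coeff_eq_zero hx (a + c) (a + b + d) b
      (by push_cast; linarith)
    obtain rfl : c = d := by omega
    have h7 : (c * x + c : ℝ) = c * (x + 1) := by ring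
    have h8 : c ≠ 0 := fun h => key h
    have h9 : (1 : ℝ) ≤ |(c : ℝ)| := by exact_mod_cast Int.one_le_abs h8
    rw [h7, abs_mul] at h2
    have h10 : |x + 1| = x + 1 := abs_of_pos (by linarith [hxm.1, hα.1])
    rw [h10] at h2
    have h11 : |x| < x + 1 := abs_lt.2 ⟨by linarith [hxm.1, hα.1], by linarith⟩
    nlinarith [hxm.1, hα.1]
  · obtain rfl : z = -x := by linarith
    exact key (quadratic_coeff_eq_zero hx c (d + a) b (by push_cast; linarith)).1
  · obtain rfl : z = 1 - x := by linarith
    exact key (quadratic_coeff_eq_zero hx c (d + a - c) (b - d) (by push_cast; linarith)).1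

lemma iterate_injective {α x : ℝ} (hα : α ∈ Ioo g 1) (hx : Transcendental ℤ x)
    (hxm : x ∈ Ico (α - 1) α) {i j : ℕ} (h : (T α)^[i] x = (T α)^[j] x) : i = j := by
  have hg := g_gt
  have aux : ∀ {i j : ℕ}, i < j → (T α)^[i] x = (T α)^[j] x → False := by
    intro i j hij h
    obtain ⟨k, rfl⟩ := Nat.exists_eq_add_of_lt hij
    rw [show i + k + 1 = (k + 1) + i by ring, Function.iterate_add_apply] at h
    refine iterate_ne_self hα (transcendental_iterate hx i) ?_ (Nat.le_add_left 1 k) h.symm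
    cases i with
    | zero => exact hxm
    | succ i => rw [Function.iterate_succ_apply']; exact T_mem (by linarith [hα.1]) hα.2.le _
  rcases lt_trichotomy i j with h' | h' | h'
  · exact (aux h' h).elim
  · exact h'
  · exact (aux h' h.symm).elim

lemma orb_injective {α : ℝ} (hα : α ∈ Ioo g 1) (ht : Transcendental ℤ α) (b : Bool) {i j : ℕ}
    (h : orb b i α = orb b j α) : i = j :=
  iterate_injective hα (transcendental_orb ht b 0) (orb_mem hα b 0) h

lemma orb_eq_of_le {α : ℝ} {b c : Bool} {i j k l : ℕ} (h : orb b i α = orb c j α) (hk : i ≤ k)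
    (hl : i + l = j + k) : orb b k α = orb c l α := by
  obtain ⟨m, rfl⟩ := Nat.exists_eq_add_of_le' hk
  obtain rfl : l = m + j := by omega
  rw [orb_add, orb_add, h]

/-- At a transcendental parameter, the orbits can only meet after an exit. -/
lemma exists_exits_of_eq {α : ℝ} (hα : α ∈ Ioo g 1) (ht : Transcendental ℤ α) {b : Bool}
    {i j : ℕ} (hij : i ≤ j) (h : orb b i α = orb (!b) j α) : ∃ n < i, Exits α n := by
  by_contra! hn
  obtain ⟨k, rfl⟩ := Nat.exists_eq_add_of_le' hij
  rw [orb_add] at h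
  exact (linked_orb hα b hn).iterate_ne hα (transcendental_orb ht _ _) (orb_mem hα _ _) k h.symm

lemma firstExit_of_matching_aux {α : ℝ} (hα : α ∈ Ioo g 1) (ht : Transcendental ℤ α) {b : Bool}
    {i j n : ℕ} (h : orb b i α = orb (!b) j α)
    (h' : orb b (i - 1) α ≠ orb (!b) (j - 1) α) (hi : n < i) (hj : n < j)
    (hn : FirstExit α n) (hb : 1 / (α + 1) < orb b n α) : n = min i j - 1 := by
  have h1 := (FirstExit.matching hα hn.2 hb).1
  have h2 : orb (!b) (j + 1) α = orb b (n + 2 + (j - n)) α :=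
    orb_eq_of_le h1.symm (by omega) (by omega)
  have h3 : orb b (i + 1) α = orb (!b) (j + 1) α := orb_eq_of_le h (by omega) (by omega)
  have h4 := orb_injective hα ht b (h3.trans h2)
  have h5 : ¬ n + 1 < j := fun hlt =>
    h' (orb_eq_of_le h1 (by omega) (by omega))
  omega

/-- At a transcendental parameter, the matching exponents determine the time of the first exit. -/
lemma firstExit_of_matching {α : ℝ} (hα : α ∈ Ioo g 1) (ht : Transcendental ℤ α) {M N : ℕ}
    (h : (T α)^[M] (α - 1) = (T α)^[N] α) (h' : (T α)^[M - 1] (α - 1) ≠ (T α)^[N - 1] α) :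
    FirstExit α (min M (N - 1) - 1) := by
  have hg := g_gt
  obtain _ | m := N
  · have := (orb_mem hα true M).2
    rw [orb_true, h] at this
    exact (lt_irrefl _ this).elim
  rw [Nat.add_sub_cancel] at h' ⊢
  rw [← orb_true, ← orb_false hα] at h
  have hex : ∃ n, n < M ∧ n < m ∧ Exits α n := by
    rcases le_total M m with hM | hM
    · obtain ⟨n, hn, hn'⟩ := exists_exits_of_eq hα ht (b := true) hM h
      exact ⟨n, hn, by omega, hn'⟩
    · obtain ⟨n, hn, hn'⟩ := exists_exits_of_eq hα ht (b := false) hM h.symm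
      exact ⟨n, by omega, hn, hn'⟩
  obtain ⟨k, hkM, hkm, hk⟩ := hex
  have hm : m = m - 1 + 1 := by omega
  rw [hm, ← orb_true, ← orb_false hα] at h'
  classical
  have hne : ∃ n, Exits α n := ⟨k, hk⟩
  have hf : FirstExit α (Nat.find hne) := ⟨Nat.find_spec hne, fun i hi => Nat.find_min hne hi⟩
  have hle : Nat.find hne ≤ k := Nat.find_min' hne hk
  obtain ⟨b, hb⟩ := hf.1
  cases b
  · rw [min_comm, ← firstExit_of_matching_aux hα ht (b := false) h.symm h'.symm
      (by omega) (by omega) hf hb]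
    exact hf
  · rw [← firstExit_of_matching_aux hα ht (b := true) h h'
      (by omega) (by omega) hf hb]
    exact hf

open Topology

lemma hasDerivAt_one_div_sub {f : ℝ → ℝ} {f' α : ℝ} (hf : HasDerivAt f f' α) (h0 : f α ≠ 0)
    (d : ℝ) : HasDerivAt (fun β => 1 / f β - d) (-f' / f α ^ 2) α := by
  simpa [one_div] using (hf.inv h0).sub_const d

lemma one_le_abs_deriv {y f' : ℝ} (hy : |y| < 1) (h0 : y ≠ 0) (h : 1 ≤ |f'|) :
    1 < |-f' / y ^ 2| := by
  have hy2 : y ^ 2 < 1 := (sq_lt_one_iff_abs_lt_one y).2 hy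
  have hy2' : 0 < y ^ 2 := by positivity
  rw [abs_div, abs_neg, abs_of_pos hy2', lt_div_iff₀ hy2']
  linarith

lemma abs_lt_one_of_mem {α y : ℝ} (hα : α ∈ Ioo g 1) (hy : y ∈ Ico (α - 1) α) : |y| < 1 := by
  have hg := g_gt
  exact abs_lt.2 ⟨by linarith [hy.1, hα.1], by linarith [hy.2, hα.2]⟩

/-- Away from the left end point of the range of `T α`, the digit is locally constant. -/
lemma eventually_T_eq {f : ℝ → ℝ} {α : ℝ} (hα : α ∈ Ioo g 1) (hf : ContinuousAt f α)
    (h0 : f α ≠ 0) (h : T α (f α) ≠ α - 1) :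
    ∀ᶠ β in 𝓝 α, T β (f β) = 1 / f β - (⌊1 / f α + 1 - α⌋ : ℝ) := by
  have hg := g_gt
  have hm := T_mem (by linarith [hα.1]) hα.2.le (f α)
  have hm1 := lt_of_le_of_ne hm.1 h.symm
  have hm2 := hm.2
  rw [T_of_ne h0] at hm1 hm2
  have hc : ContinuousAt (fun β => 1 / f β - (⌊1 / f α + 1 - α⌋ : ℝ)) α :=
    (continuousAt_const.div hf h0).sub continuousAt_const
  filter_upwards [hf.eventually_ne h0, hc.eventually_lt continuousAt_id hm2,
    (continuousAt_id.sub continuousAt_const).eventually_lt hc hm1] with β h1 h2 h3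
  exact T_eq_of_mem h1 _ ⟨h3.le, h2⟩

lemma continuousAt_bound {α : ℝ} (hα : α ∈ Ioo g 1) : ContinuousAt (fun β => 1 / (β + 1)) α := by
  have hg := g_gt
  exact continuousAt_const.div (continuousAt_id.add continuousAt_const)
    (by change α + 1 ≠ 0; linarith [hα.1])

lemma eventually_lt_bound {f : ℝ → ℝ} {α : ℝ} (hα : α ∈ Ioo g 1) (hf : ContinuousAt f α)
    (hle : f α ≤ 1 / (α + 1)) (h : T α (f α) ≠ α - 1) :
    ∀ᶠ β in 𝓝 α, f β ≤ 1 / (β + 1) :=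
  (hf.eventually_lt (continuousAt_bound hα)
    (lt_of_le_of_ne hle fun h' => h (T_eq_of_eq hα h'))).mono fun _ h => h.le

/-- Up to time `n`, the critical orbits avoid the discontinuities of `T`. -/
def Regular (α : ℝ) (n : ℕ) : Prop :=
  ∀ b, (∀ i < n, orb b i α ≠ 0) ∧ ∀ i, 1 ≤ i → i ≤ n → orb b i α ≠ α - 1

lemma Regular.mono {α : ℝ} {m n : ℕ} (h : Regular α n) (hmn : m ≤ n) : Regular α m :=
  fun b => ⟨fun i hi => (h b).1 i (by omega), fun i h1 hi => (h b).2 i h1 (by omega)⟩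

lemma Regular.hasDerivAt {α : ℝ} (hα : α ∈ Ioo g 1) {n : ℕ} (h : Regular α n) (b : Bool) :
    ∃ f', HasDerivAt (orb b n) f' α ∧ 1 ≤ |f'| := by
  have hg := g_gt
  have hα0 : 0 < α := by linarith [hα.1]
  induction n with
  | zero =>
    cases b
    · refine ⟨-1 / α ^ 2, ?_, ?_⟩
      · exact hasDerivAt_one_div_sub (hasDerivAt_id α) hα0.ne' 1
      · exact (one_le_abs_deriv (by rw [abs_of_pos hα0]; exact hα.2) hα0.ne' (by simp)).le
    · exact ⟨1, (hasDerivAt_id α).sub_const 1, by simp⟩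
  | succ n ih =>
    obtain ⟨f', hf, hf'⟩ := ih (h.mono n.le_succ)
    have h0 := (h b).1 n n.lt_succ_self
    have h1 := (h b).2 (n + 1) (by omega) le_rfl
    rw [orb_succ] at h1
    refine ⟨_, (hasDerivAt_one_div_sub hf h0
      (⌊1 / orb b n α + 1 - α⌋ : ℝ)).congr_of_eventuallyEq ?_,
      (one_le_abs_deriv (abs_lt_one_of_mem hα (orb_mem hα b n)) h0 hf').le⟩
    filter_upwards [eventually_T_eq hα hf.continuousAt h0 h1] with β hβ
    rw [orb_succ, hβ]

lemma Regular.continuousAt {α : ℝ} (hα : α ∈ Ioo g 1) {n : ℕ} (h : Regular α n) (b : Bool) :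
    ContinuousAt (orb b n) α := by
  obtain ⟨f', hf, -⟩ := h.hasDerivAt hα b
  exact hf.continuousAt

lemma Regular.eventually {α : ℝ} (hα : α ∈ Ioo g 1) {n : ℕ} (h : Regular α n) :
    ∀ᶠ β in 𝓝 α, Regular β n := by
  refine Filter.eventually_all.2 fun b => ?_
  refine ((eventually_all_finite (Set.finite_Iio n)).2 fun i hi => ?_).and
    (((eventually_all_finite (Set.finite_Icc 1 n)).2 fun i hi => ?_).mono
      fun β hβ i h1 h2 => hβ i ⟨h1, h2⟩)
  · exact ((h.mono (le_of_lt hi)).continuousAt hα b).eventually_ne ((h b).1 i hi)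
  · exact ((((h.mono hi.2).continuousAt hα b).sub
      (continuousAt_id.sub continuousAt_const)).eventually_ne
        (sub_ne_zero.2 ((h b).2 i hi.1 hi.2))).mono fun β hβ => sub_ne_zero.1 hβ

lemma Regular.eventually_not_exits {α : ℝ} (hα : α ∈ Ioo g 1) {n : ℕ} (h : Regular α (n + 1))
    (hn : ¬ Exits α n) : ∀ᶠ β in 𝓝 α, ¬ Exits β n := by
  have : ∀ᶠ β in 𝓝 α, ∀ b, orb b n β ≤ 1 / (β + 1) := by
    refine Filter.eventually_all.2 fun b => ?_
    refine eventually_lt_bound hα ((h.mono n.le_succ).continuousAt hα b)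
      (le_of_not_exits hn b) ?_
    rw [← orb_succ]
    exact (h b).2 (n + 1) (by omega) le_rfl
  filter_upwards [this] with β hβ
  rintro ⟨b, hb⟩
  exact hb.not_ge (hβ b)

lemma Regular.eventually_forall_not_exits {α : ℝ} (hα : α ∈ Ioo g 1) {n : ℕ} (h : Regular α n)
    (hn : ∀ i < n, ¬ Exits α i) : ∀ᶠ β in 𝓝 α, ∀ i < n, ¬ Exits β i :=
  (eventually_all_finite (Set.finite_Iio n)).2 fun i hi =>
    (h.mono (Nat.succ_le_of_lt hi)).eventually_not_exits hα (hn i hi)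

/-- Two filters are the two one-sided neighbourhood filters of `α`, in some order. -/
def Sides (α : ℝ) (l l' : Filter ℝ) : Prop :=
  (l = 𝓝[>] α ∧ l' = 𝓝[<] α) ∨ (l = 𝓝[<] α ∧ l' = 𝓝[>] α)

lemma exists_sides_of_hasDerivAt {h : ℝ → ℝ} {h' α : ℝ} (hd : HasDerivAt h h' α) (h0 : h α = 0)
    (hne : h' ≠ 0) : ∃ l l', Sides α l l' ∧ (∀ᶠ β in l, 0 < h β) ∧ ∀ᶠ β in l', h β < 0 := by
  rcases lt_or_gt_of_ne hne with hlt | hgt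
  · have := eventually_nhdsWithin_sign_eq_of_deriv_neg (by rwa [hd.deriv]) h0
    refine ⟨𝓝[<] α, 𝓝[>] α, Or.inr ⟨rfl, rfl⟩, ?_, ?_⟩
    · filter_upwards [this.filter_mono nhdsWithin_le_nhds, self_mem_nhdsWithin] with β h1 h2
      rwa [sign_pos (sub_pos.2 h2), sign_eq_one_iff] at h1
    · filter_upwards [this.filter_mono nhdsWithin_le_nhds, self_mem_nhdsWithin] with β h1 h2
      rwa [sign_neg (sub_neg.2 h2), sign_eq_neg_one_iff] at h1
  · have := eventually_nhdsWithin_sign_eq_of_deriv_pos (by rwa [hd.deriv]) h0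
    refine ⟨𝓝[>] α, 𝓝[<] α, Or.inl ⟨rfl, rfl⟩, ?_, ?_⟩
    · filter_upwards [this.filter_mono nhdsWithin_le_nhds, self_mem_nhdsWithin] with β h1 h2
      rwa [sign_pos (sub_pos.2 h2), sign_eq_one_iff] at h1
    · filter_upwards [this.filter_mono nhdsWithin_le_nhds, self_mem_nhdsWithin] with β h1 h2
      rwa [sign_neg (sub_neg.2 h2), sign_eq_neg_one_iff] at h1

lemma exists_sides_of_return {α : ℝ} (hα : α ∈ Ioo g 1) {b : Bool} {k : ℕ} (hr : Regular α k)
    (h0 : ∀ c, orb c k α ≠ 0) (h1 : orb b (k + 1) α = α - 1) (hex : ∀ i ≤ k, ¬ Exits α i) :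
    ∃ l l', Sides α l l' ∧ (∀ᶠ β in l, ∀ i ≤ k + 1, ¬ Exits β i) ∧
      ∀ᶠ β in l', Exits β (k + 1) := by
  have hg := g_gt
  have hα0 : 0 < α := by linarith [hα.1]
  obtain ⟨f', hf, hf'⟩ := hr.hasDerivAt hα b
  have hfα := orb_mem hα b k
  have hd := one_le_abs_deriv (abs_lt_one_of_mem hα hfα) (h0 b) hf'
  set d := ⌊1 / orb b k α + 1 - α⌋ with hdd
  have hb : 1 / orb b k α - d = α - 1 := by rw [← h1, orb_succ, T_of_ne (h0 b)]
  have hP := hasDerivAt_one_div_sub hf (h0 b) (d : ℝ)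
  have hder : HasDerivAt (fun β => 1 / orb b k β - d - (β - 1)) (-f' / orb b k α ^ 2 - 1) α :=
    hP.sub ((hasDerivAt_id α).sub_const 1)
  have hne : -f' / orb b k α ^ 2 - 1 ≠ 0 := by
    intro h
    rw [sub_eq_zero] at h
    rw [h, abs_one] at hd
    exact lt_irrefl _ hd
  obtain ⟨l, l', hl, hpos, hneg⟩ := exists_sides_of_hasDerivAt hder (sub_eq_zero.2 hb) hne
  have hle : l ≤ 𝓝 α ∧ l' ≤ 𝓝 α := by
    rcases hl with ⟨rfl, rfl⟩ | ⟨rfl, rfl⟩ <;> exact ⟨nhdsWithin_le_nhds, nhdsWithin_le_nhds⟩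
  obtain ⟨b1, b2, b3, b4⟩ := bounds hα
  have hlink := linked_orb hα b (n := k + 1) fun i hi => hex i (by omega)
  have hother := hlink.of_eq hα (orb_mem hα _ _) h1
  have hother1 : orb (!b) (k + 1) α ≠ α - 1 := by
    rcases hother with h | h
    · rw [h]; intro h2; linarith [(inv_sub_one_mem hα).1, hα.2]
    · rw [h]; intro h2; linarith [hα.2]
  have hother2 : orb (!b) (k + 1) α < 1 / (α + 1) := by
    rcases hother with h | h <;> rw [h] <;> assumption
  rw [orb_succ] at hother1
  have hcont := hr.continuousAt hα (!b)
  have hother3 : ContinuousAt (orb (!b) (k + 1)) α := by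
    refine (((continuousAt_const (y := (1 : ℝ))).div hcont (h0 _)).sub
      (continuousAt_const (y := (⌊1 / orb (!b) k α + 1 - α⌋ : ℝ)))).congr ?_
    filter_upwards [eventually_T_eq hα hcont (h0 _) hother1] with β hβ
    rw [orb_succ, hβ]
    rfl
  have hmem : ∀ᶠ β in 𝓝 α, β ∈ Ioo g 1 := isOpen_Ioo.mem_nhds hα
  have hPlt : ∀ᶠ β in 𝓝 α, 1 / orb b k β - d < 1 / (β + 1) :=
    hP.continuousAt.eventually_lt (continuousAt_bound hα) (by rw [hb]; exact b1)
  refine ⟨l, l', hl, ?_, ?_⟩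
  · filter_upwards [hpos, hle.1 hmem, hle.1 hPlt, hle.1 (hf.continuousAt.eventually_ne (h0 b)),
      hle.1 (hr.eventually_forall_not_exits hα fun i hi => hex i hi.le),
      hle.1 (eventually_lt_bound hα hcont (le_of_not_exits (hex k le_rfl) _) hother1),
      hle.1 (hother3.eventually_lt (continuousAt_bound hα) hother2)] with β c1 c2 c3 c4 c5 c6 c7
    have hT : T β (orb b k β) = 1 / orb b k β - d :=
      T_eq_of_mem c4 d ⟨by linarith, c3.trans (bounds c2).2.2.2⟩
    intro i hi
    obtain hi | rfl | rfl : i < k ∨ i = k ∨ i = k + 1 := by omega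
    · exact c5 i hi
    · rintro ⟨c, hc⟩
      obtain rfl | rfl : c = b ∨ c = !b := by cases b <;> cases c <;> simp
      · have hd1 : (d : ℝ) = 1 := by
          have := T_of_gt c2 (orb_mem c2 c i) hc
          linarith
        rw [hd1] at hb
        have h2 : 1 / orb c i α = α := by linarith
        have h3 : orb c i α * α = 1 := by
          field_simp [h0 c] at h2
          linarith
        nlinarith [hfα.2, hα.2]
      · exact hc.not_ge c6
    · rintro ⟨c, hc⟩
      obtain rfl | rfl : c = b ∨ c = !b := by cases b <;> cases c <;> simp
      · rw [orb_succ, hT] at hc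
        linarith
      · linarith
  · have hPgt : ∀ᶠ β in 𝓝 α, 1 / (β + 1) < 1 / orb b k β - ((d - 1 : ℤ) : ℝ) := by
      refine (continuousAt_bound hα).eventually_lt
        (hasDerivAt_one_div_sub hf (h0 b) ((d - 1 : ℤ) : ℝ)).continuousAt ?_
      push_cast
      linarith
    filter_upwards [hneg, hle.2 hmem, hle.2 hPgt,
      hle.2 (hf.continuousAt.eventually_ne (h0 b))] with β c1 c2 c3 c4
    refine ⟨b, ?_⟩
    rw [orb_succ, T_eq_of_mem c4 (d - 1) ⟨?_, ?_⟩]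
    · exact c3
    · linarith [(bounds c2).1]
    · push_cast; linarith

/-- First exits at time `n` accumulate at `α` from both sides. -/
def BothSides (α : ℝ) (n : ℕ) : Prop :=
  (∃ᶠ β in 𝓝[>] α, FirstExit β n) ∧ ∃ᶠ β in 𝓝[<] α, FirstExit β n

lemma not_bothSides_of_return {α : ℝ} (hα : α ∈ Ioo g 1) {b : Bool} {k : ℕ} (hr : Regular α k)
    (h0 : ∀ c, orb c k α ≠ 0) (h1 : orb b (k + 1) α = α - 1) (hex : ∀ i ≤ k, ¬ Exits α i)
    (n : ℕ) : ¬ BothSides α n := by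
  rintro ⟨hgt, hlt⟩
  obtain ⟨l, l', hl, hno, hyes⟩ := exists_sides_of_return hα hr h0 h1 hex
  have hf : (∃ᶠ β in l, FirstExit β n) ∧ ∃ᶠ β in l', FirstExit β n := by
    rcases hl with ⟨rfl, rfl⟩ | ⟨rfl, rfl⟩
    exacts [⟨hgt, hlt⟩, ⟨hlt, hgt⟩]
  obtain ⟨β, hβ, hβ'⟩ := (hf.1.and_eventually hno).exists
  obtain ⟨γ, hγ, hγ'⟩ := (hf.2.and_eventually hyes).exists
  have h2 : ¬ n ≤ k + 1 := fun h => hβ' n h hβ.1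
  exact hγ.2 (k + 1) (by omega) hγ'

lemma exists_return_near_zero {α : ℝ} (hα : α ∈ Ioo g 1) {W : Set ℝ} (hW : W ∈ 𝓝 α) {b : Bool}
    {k : ℕ} (hr : Regular α k) (h0 : orb b k α = 0) (hex : ∀ i ≤ k, ¬ Exits α i) :
    ∃ β ∈ W ∩ Ioo g 1, Regular β k ∧ (∀ c, orb c k β ≠ 0) ∧ orb b (k + 1) β = β - 1 ∧
      ∀ i ≤ k, ¬ Exits β i := by
  have hg := g_gt
  have hlink := linked_orb hα b (n := k) fun i hi => hex i hi.le
  have h0' : ∀ c, orb c k α = 0 := fun c => by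
    obtain rfl | rfl : c = b ∨ c = !b := by cases b <;> cases c <;> simp
    · exact h0
    · exact hlink.eq_zero hα (orb_mem hα _ _) h0
  have hk : ∀ᶠ β in 𝓝 α, ∀ c, orb c k β < 1 / (β + 1) :=
    Filter.eventually_all.2 fun c => (hr.continuousAt hα c).eventually_lt (continuousAt_bound hα)
      (by rw [h0' c]; exact one_div_pos.2 (by linarith [hα.1]))
  have hmem : ∀ᶠ β in 𝓝 α, β ∈ Ioo g 1 := isOpen_Ioo.mem_nhds hα
  have hall : ∀ᶠ β in 𝓝 α, (β ∈ W ∩ Ioo g 1 ∧ Regular β k) ∧ ∀ i ≤ k, ¬ Exits β i := by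
    filter_upwards [hW, hmem, hr.eventually hα,
      hr.eventually_forall_not_exits hα fun i hi => hex i hi.le, hk] with β c1 c2 c3 c4 c5
    refine ⟨⟨⟨c1, c2⟩, c3⟩, fun i hi => ?_⟩
    rcases hi.lt_or_eq with hi | rfl
    · exact c4 i hi
    · rintro ⟨c, hc⟩
      exact hc.not_gt (c5 c)
  obtain ⟨ε, hε, hball⟩ := Metric.eventually_nhds_iff_ball.1 hall
  obtain ⟨f', hf, hf'⟩ := hr.hasDerivAt hα b
  have hf'0 : f' ≠ 0 := by rintro rfl; norm_num at hf'
  have hne : ∀ᶠ β in 𝓝[≠] α, orb b k β ≠ 0 := hf.eventually_ne hf'0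
  obtain ⟨γ, hγ, hγb⟩ := (hne.and
    (nhdsWithin_le_nhds (Metric.ball_mem_nhds α hε))).exists
  obtain ⟨K, hK⟩ : ∃ K : ℤ, 0 < orb b k γ * (K - 1 + γ) - 1 := by
    rcases lt_or_gt_of_ne hγ with hneg | hpos
    · obtain ⟨K, hK⟩ := exists_int_lt (1 / orb b k γ + 1 - γ)
      refine ⟨K, ?_⟩
      have h2 : K - 1 + γ < 1 / orb b k γ := by linarith
      rw [lt_div_iff_of_neg hneg] at h2
      linarith
    · obtain ⟨K, hK⟩ := exists_int_gt (1 / orb b k γ + 1 - γ)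
      refine ⟨K, ?_⟩
      have h2 : 1 / orb b k γ < K - 1 + γ := by linarith
      rw [div_lt_iff₀ hpos] at h2
      linarith
  have hsub : uIcc α γ ⊆ Metric.ball α ε := by
    rw [Real.ball_eq_Ioo]
    refine Set.ordConnected_Ioo.uIcc_subset ?_ ?_
    · rw [← Real.ball_eq_Ioo]; exact Metric.mem_ball_self hε
    · rwa [← Real.ball_eq_Ioo]
  have hcont : ContinuousOn (fun β => orb b k β * (K - 1 + β) - 1) (uIcc α γ) := fun β hβ => by
    have := hball β (hsub hβ)
    exact (((this.1.2.continuousAt this.1.1.2 b).mul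
      (continuousAt_const.add continuousAt_id)).sub continuousAt_const).continuousWithinAt
  obtain ⟨β, hβ, hβ0⟩ := intermediate_value_uIcc hcont (show (0 : ℝ) ∈ uIcc _ _ by
    rw [h0, mem_uIcc]; left; constructor <;> linarith)
  obtain ⟨⟨hβW, hβr⟩, hβex⟩ := hball β (hsub hβ)
  have h2 : orb b k β * (K - 1 + β) = 1 := by
    have : orb b k β * (K - 1 + β) - 1 = 0 := hβ0
    linarith
  have h3 : orb b k β ≠ 0 := left_ne_zero_of_mul_eq_one h2
  have h4 : 1 / orb b k β = K - 1 + β := by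
    rw [div_eq_iff h3]; linarith
  have hβlink := linked_orb hβW.2 b (n := k) fun i hi => hβex i hi.le
  refine ⟨β, hβW, hβr, fun c hc => ?_, ?_, hβex⟩
  · obtain rfl | rfl : c = b ∨ c = !b := by cases b <;> cases c <;> simp
    · exact h3 hc
    · exact h3 (hβlink.symm.eq_zero hβW.2 (orb_mem hβW.2 _ _) hc)
  · rw [orb_succ, T_eq_of_mem h3 K ⟨?_, ?_⟩] <;> rw [h4] <;> linarith

lemma exists_not_bothSides {α : ℝ} (hα : α ∈ Ioo g 1) {W : Set ℝ} (hW : W ∈ 𝓝 α)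
    (hex : ∀ i, ¬ Exits α i) (n : ℕ) : ∃ β ∈ W ∩ Ioo g 1, ¬ BothSides β n := by
  classical
  by_cases hreg : ∀ m, Regular α m
  · refine ⟨α, ⟨mem_of_mem_nhds hW, hα⟩, fun h => ?_⟩
    have := (hreg (n + 1)).eventually_not_exits hα (hex n)
    obtain ⟨β, hβ, hβ'⟩ := (h.1.and_eventually (this.filter_mono nhdsWithin_le_nhds)).exists
    exact hβ' hβ.1
  push Not at hreg
  obtain ⟨k, hk⟩ : ∃ k, Nat.find hreg = k + 1 := by
    refine Nat.exists_eq_succ_of_ne_zero fun h => ?_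
    have := Nat.find_spec hreg
    rw [h] at this
    exact this fun b => ⟨fun i hi => by omega, fun i h1 h2 => by omega⟩
  have hr : Regular α k := not_not.1 (Nat.find_min hreg (by omega))
  have hr' : ¬ Regular α (k + 1) := hk ▸ Nat.find_spec hreg
  by_cases h0 : ∃ b, orb b k α = 0
  · obtain ⟨b, hb⟩ := h0
    obtain ⟨β, hβ, h1, h2, h3, h4⟩ := exists_return_near_zero hα hW hr hb fun i _ => hex i
    exact ⟨β, hβ, not_bothSides_of_return hβ.2 h1 h2 h3 h4 n⟩
  · push Not at h0
    have h1 : ∃ b, orb b (k + 1) α = α - 1 := by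
      by_contra! h1
      refine hr' fun b => ⟨fun i hi => ?_, fun i h2 h3 => ?_⟩
      · rcases (Nat.lt_succ_iff.1 hi).lt_or_eq with hi | rfl
        exacts [(hr b).1 i hi, h0 b]
      · rcases h3.lt_or_eq with hi | rfl
        exacts [(hr b).2 i h2 (by omega), h1 b]
    obtain ⟨b, hb⟩ := h1
    exact ⟨α, ⟨mem_of_mem_nhds hW, hα⟩,
      not_bothSides_of_return hα hr h0 hb (fun i _ => hex i) n⟩

lemma T_inv_sub_one {α : ℝ} (hα : α ∈ Ioo g 1) : T α (1 / α - 1) = T α (1 - α) := by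
  have hg := g_gt
  have h1 : 1 - α ≠ 0 := by linarith [hα.2]
  have h0 : α ≠ 0 := by linarith [hα.1]
  refine T_eq_T (inv_sub_one_mem hα).1.ne' h1 (-1) ?_
  rw [show 1 / α - 1 = (1 - α) / α by field_simp]
  field_simp
  push_cast
  ring

lemma FirstExit.regular {α : ℝ} (hα : α ∈ Ioo g 1) {n : ℕ} (h : FirstExit α n) : Regular α n := by
  obtain ⟨b1, b2, b3, -⟩ := bounds hα
  have hg := g_gt
  have hlink : ∀ i ≤ n, ∀ c, Linked (orb c i α) (orb (!c) i α) := fun i hi c =>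
    linked_orb hα c fun j hj => h.2 j (by omega)
  refine fun b => ⟨fun i hi h0 => ?_, fun i h1 hi h0 => ?_⟩
  · have hall : ∀ k, ∀ c, orb c (k + i) α = 0 := fun k => by
      induction k with
      | zero =>
        intro c
        rw [Nat.zero_add]
        obtain rfl | rfl : c = b ∨ c = !b := by cases b <;> cases c <;> simp
        exacts [h0, (hlink i hi.le b).eq_zero hα (orb_mem hα _ _) h0]
      | succ k ih => intro c; rw [Nat.add_right_comm, orb_succ, ih, T_zero]
    obtain ⟨c, hc⟩ := h.1
    rw [← Nat.sub_add_cancel hi.le, hall] at hc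
    exact hc.not_ge (one_div_nonneg.2 (by linarith [hα.1]))
  · have hother := (hlink i hi b).of_eq hα (orb_mem hα _ _) h0
    rcases hi.lt_or_eq with hi | rfl
    · have h2 : orb b (i + 1) α = orb true 1 α := by rw [orb_succ, h0, orb_succ, orb_true_zero]
      have h3 : orb (!b) (i + 1) α = orb false 1 α := by
        rw [orb_succ, orb_succ, orb_false_zero]
        rcases hother with h | h <;> rw [h]
        exact (T_inv_sub_one hα).symm
      obtain ⟨c, hc⟩ := h.1
      refine h.2 (n - i) (by omega) ?_
      obtain rfl | rfl : c = b ∨ c = !b := by cases b <;> cases c <;> simp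
      · exact ⟨true, by rwa [← orb_eq_of_le h2 (k := n) (l := n - i) (by omega) (by omega)]⟩
      · exact ⟨false, by rwa [← orb_eq_of_le h3 (k := n) (l := n - i) (by omega) (by omega)]⟩
    · obtain ⟨c, hc⟩ := h.1
      obtain rfl | rfl : c = b ∨ c = !b := by cases b <;> cases c <;> simp
      · linarith
      · rcases hother with h | h <;> linarith

lemma mem_matchingSet_of_Ioo {a b x : ℝ} {M N : ℕ} (hx : x ∈ Ioo a b) (hI : Ioo a b ⊆ Icc 0 1)
    (hm : ∀ α ∈ Ioo a b, (T α)^[M] (α - 1) = (T α)^[N] α)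
    (hne : ∀ᵐ α ∂(volume.restrict (Ioo a b)), (T α)^[M - 1] (α - 1) ≠ (T α)^[N - 1] α) :
    x ∈ MatchingSet := by
  set F : Set (Set ℝ) := {J | (∃ a b : ℝ, a < b ∧ J = Ioo a b) ∧ J ⊆ Icc 0 1 ∧
    (∀ α ∈ J, (T α)^[M] (α - 1) = (T α)^[N] α) ∧
    (∀ᵐ α ∂(volume.restrict J), (T α)^[M - 1] (α - 1) ≠ (T α)^[N - 1] α) ∧ x ∈ J} with hF
  have hmemF : Ioo a b ∈ F := ⟨⟨a, b, hx.1.trans hx.2, rfl⟩, hI, hm, hne, hx⟩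
  have hopen : ∀ J ∈ F, IsOpen J := by
    rintro J ⟨⟨c, d, -, rfl⟩, -⟩
    exact isOpen_Ioo
  have hVopen : IsOpen (⋃₀ F) := isOpen_sUnion hopen
  have hxV : x ∈ ⋃₀ F := ⟨_, hmemF, hx⟩
  have hVsub : ⋃₀ F ⊆ Icc 0 1 := sUnion_subset fun J hJ => hJ.2.1
  have hVconn : IsPreconnected (⋃₀ F) := by
    refine isPreconnected_sUnion x F (fun J hJ => hJ.2.2.2.2) ?_
    rintro J ⟨⟨c, d, -, rfl⟩, -⟩
    exact isPreconnected_Ioo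
  have hbb : BddBelow (⋃₀ F) := bddBelow_Icc.mono hVsub
  have hba : BddAbove (⋃₀ F) := bddAbove_Icc.mono hVsub
  have hVeq : ⋃₀ F = Ioo (sInf (⋃₀ F)) (sSup (⋃₀ F)) := by
    refine Subset.antisymm ?_ (IsConnected.Ioo_csInf_csSup_subset ⟨⟨x, hxV⟩, hVconn⟩ hbb hba)
    rintro y ⟨J, hJ, hyJ⟩
    obtain ⟨c, d, -, rfl⟩ := hJ.1
    constructor
    · obtain ⟨z, hz, hzy⟩ := exists_between hyJ.1
      exact lt_of_le_of_lt (csInf_le hbb ⟨_, hJ, hz, hzy.trans hyJ.2⟩) hzy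
    · obtain ⟨z, hyz, hz⟩ := exists_between hyJ.2
      exact lt_of_lt_of_le hyz (le_csSup hba ⟨_, hJ, hyJ.1.trans hyz, hz⟩)
  refine ⟨⋃₀ F, M, N, ⟨⟨_, _, ?_, hVeq⟩, hVsub, ?_, ?_, ?_⟩, hxV⟩
  · have := hVeq ▸ hxV
    exact this.1.trans this.2
  · rintro α ⟨J, hJ, hα⟩
    exact hJ.2.2.1 α hα
  · rw [ae_restrict_iff' hVopen.measurableSet]
    refine measure_null_of_locally_null _ fun y hy => ?_
    obtain ⟨⟨J, hJ, hyJ⟩, -⟩ := Classical.not_imp.1 hy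
    have h1 := (ae_restrict_iff' (hopen J hJ).measurableSet).1 hJ.2.2.2.1
    refine ⟨_, inter_mem_nhdsWithin _ ((hopen J hJ).mem_nhds hyJ), measure_mono_null ?_ h1⟩
    rintro z ⟨hz, hzJ⟩ h
    exact hz fun _ => h hzJ
  · intro J' h1 h2 h3 h4 h5
    exact Subset.antisymm (subset_sUnion_of_mem ⟨h1, h2, h3, h4, h5 hxV⟩) h5

lemma mem_matchingSet_of_firstExit {α : ℝ} (hα : α ∈ Ioo g 1) {n : ℕ} (h : FirstExit α n) :
    α ∈ MatchingSet := by
  have hg := g_gt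
  have hr := h.regular hα
  obtain ⟨b, hb⟩ := h.1
  have hev : ∀ᶠ β in 𝓝 α, (β ∈ Ioo g 1 ∧ ∀ i < n, ¬ Exits β i) ∧ 1 / (β + 1) < orb b n β :=
    ((isOpen_Ioo.eventually_mem hα).and
      (hr.eventually_forall_not_exits hα h.2)).and
      ((continuousAt_bound hα).eventually_lt (hr.continuousAt hα b) hb)
  obtain ⟨c, d, hcd, hsub⟩ := mem_nhds_iff_exists_Ioo_subset.1 hev
  have hI : Ioo c d ⊆ Icc 0 1 := fun β hβ =>
    have := (hsub hβ).1.1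
    ⟨by linarith [this.1], this.2.le⟩
  have hmatch : ∀ β ∈ Ioo c d, orb b (n + 2) β = orb (!b) (n + 1) β ∧
      orb b (n + 1) β ≠ orb (!b) n β := fun β hβ =>
    FirstExit.matching (hsub hβ).1.1 (hsub hβ).1.2 (hsub hβ).2
  cases b
  · refine mem_matchingSet_of_Ioo (M := n + 1) (N := n + 3) hcd hI (fun β hβ => ?_) ?_
    · rw [← orb_true, ← orb_false (hsub hβ).1.1]
      exact (hmatch β hβ).1.symm
    · refine (ae_restrict_iff' measurableSet_Ioo).2 (Eventually.of_forall fun β hβ => ?_)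
      rw [← orb_true, show n + 3 - 1 = n + 1 + 1 by omega, ← orb_false (hsub hβ).1.1]
      exact (hmatch β hβ).2.symm
  · refine mem_matchingSet_of_Ioo (M := n + 2) (N := n + 2) hcd hI (fun β hβ => ?_) ?_
    · rw [← orb_true, ← orb_false (hsub hβ).1.1]
      exact (hmatch β hβ).1
    · refine (ae_restrict_iff' measurableSet_Ioo).2 (Eventually.of_forall fun β hβ => ?_)
      rw [← orb_true, show n + 2 - 1 = n + 1 by omega, ← orb_false (hsub hβ).1.1]
      exact (hmatch β hβ).2

lemma frequently_of_ae {p : ℝ → Prop} (hp : ∀ᵐ β, p β) (α : ℝ) :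
    (∃ᶠ β in 𝓝[>] α, p β) ∧ ∃ᶠ β in 𝓝[<] α, p β := by
  have aux : ∀ c d : ℝ, c < d → ¬ Ioo c d ⊆ {β | ¬ p β} := fun c d hcd h => by
    have h1 : volume (Ioo c d) = 0 := measure_mono_null h hp
    rw [Real.volume_Ioo, ENNReal.ofReal_eq_zero] at h1
    linarith
  constructor <;> intro h
  · obtain ⟨c, hc, hsub⟩ := mem_nhdsGT_iff_exists_Ioo_subset.1 h
    exact aux _ _ hc hsub
  · obtain ⟨c, hc, hsub⟩ := mem_nhdsLT_iff_exists_Ioo_subset.1 h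
    exact aux _ _ hc hsub

lemma ae_transcendental : ∀ᵐ β : ℝ, Transcendental ℤ β := by
  have h : {β : ℝ | IsAlgebraic ℤ β}.Countable := Algebraic.countable ℤ ℝ
  simpa [Transcendental] using h.ae_notMem volume

lemma ae_firstExit {J : Set ℝ} {M N : ℕ} (h : IsMatchingInterval J M N) :
    ∀ᵐ β : ℝ, β ∈ J ∩ Ioo g 1 → FirstExit β (min M (N - 1) - 1) := by
  obtain ⟨⟨a, b, -, rfl⟩, -, hm, hne, -⟩ := h
  filter_upwards [ae_transcendental, (ae_restrict_iff' measurableSet_Ioo).1 hne] with β h1 h2 h3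
  exact firstExit_of_matching h3.2 h1 (hm β h3.1) (h2 h3.1)

lemma not_mem_matchingSet {α : ℝ} (hα : α ∈ Ioo g 1) (hex : ∀ i, ¬ Exits α i) :
    α ∉ MatchingSet := by
  rintro ⟨J, M, N, hJ, hαJ⟩
  have hopen : IsOpen J := by
    obtain ⟨⟨a, b, -, rfl⟩, -⟩ := hJ
    exact isOpen_Ioo
  obtain ⟨β, hβ, hβ'⟩ := exists_not_bothSides hα (hopen.mem_nhds hαJ) hex (min M (N - 1) - 1)
  have hf := frequently_of_ae (ae_firstExit hJ) β
  have hU : ∀ᶠ γ in 𝓝 β, γ ∈ J ∩ Ioo g 1 := (hopen.inter isOpen_Ioo).mem_nhds hβ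
  exact hβ' ⟨(hf.1.and_eventually (hU.filter_mono nhdsWithin_le_nhds)).mono fun γ h => h.1 h.2,
    (hf.2.and_eventually (hU.filter_mono nhdsWithin_le_nhds)).mono fun γ h => h.1 h.2⟩

lemma T_near_one_sub_g {α w : ℝ} (hα : α ∈ Ioo g 1) (hw : w ∈ Ioc (1 / 3) (1 - α)) :
    3 - 1 / w ∈ Ioo 0 (1 - α) ∧ T α w = 1 / w - 3 ∧ T α (-w) = 3 - 1 / w := by
  have hg := g_gt
  have hw0 : 0 < w := lt_trans (by norm_num) hw.1
  have h1 : 1 / w < 3 := by rw [div_lt_iff₀ hw0]; linarith [hw.1]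
  have h2 : 3 - 1 / w < w := by
    have : 3 - w < 1 / w := by
      rw [lt_div_iff₀ hw0]
      nlinarith [g_sq, hw.2, hα.1]
    linarith
  refine ⟨⟨by linarith, by linarith [hw.2]⟩, ?_, ?_⟩
  · have := T_eq_of_mem (α := α) hw0.ne' 3
      ⟨by push_cast; linarith [hw.2], by push_cast; linarith [hα.1]⟩
    simpa using this
  · have h3 : 1 / -w = -(1 / w) := by rw [one_div_neg_eq_neg_one_div]
    have := T_eq_of_mem (α := α) (neg_ne_zero.2 hw0.ne') (-3)
      ⟨by rw [h3]; push_cast; linarith [hα.2], by rw [h3]; push_cast; linarith [hw.2, hα.1]⟩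
    rw [this, h3]
    push_cast
    ring

lemma tendsto_three_sub {l : Filter ℝ} {f : ℝ → ℝ} (h : Tendsto f l (𝓝 (1 - g))) :
    Tendsto (fun β => 3 - 1 / f β) l (𝓝 (1 - g)) := by
  have hg := g_lt
  have h1 : 1 - g = 3 - 1 / (1 - g) := by
    have : 1 - g ≠ 0 := by linarith
    field_simp
    nlinarith [g_sq]
  rw [h1]
  exact tendsto_const_nhds.sub (tendsto_const_nhds.div h (by linarith))

lemma eventually_orb_near_g (n : ℕ) : ∃ b, Tendsto (orb b (n + 1)) (𝓝[>] g) (𝓝 (1 - g)) ∧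
    ∀ᶠ β in 𝓝[>] g, orb (!b) (n + 1) β = -orb b (n + 1) β ∧
      orb b (n + 1) β ∈ Ioo (1 / 3) (1 - β) := by
  have hg := g_gt
  have hg' := g_lt
  have hmem : ∀ᶠ β in 𝓝[>] g, β ∈ Ioo g (2 / 3) := Ioo_mem_nhdsGT hg'
  induction n with
  | zero =>
    have key : ∀ᶠ β in 𝓝[>] g, 3 - 1 / (1 - β) = orb true 1 β ∧
        orb false 1 β = -orb true 1 β ∧ orb true 1 β < 1 - β := by
      filter_upwards [hmem] with β hβ
      have hβ' : β ∈ Ioo g 1 := ⟨hβ.1, by linarith [hβ.2]⟩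
      obtain ⟨h1, h2, h3⟩ := T_near_one_sub_g hβ' (w := 1 - β) ⟨by linarith [hβ.2], le_rfl⟩
      rw [neg_sub] at h3
      rw [orb_succ, orb_succ, orb_true_zero, orb_false_zero, T_inv_sub_one hβ', h2, h3]
      exact ⟨rfl, by ring, h1.2⟩
    have ht : Tendsto (orb true 1) (𝓝[>] g) (𝓝 (1 - g)) := by
      refine (tendsto_three_sub (f := fun β => 1 - β) ?_).congr' (key.mono fun β h => h.1)
      exact ((continuous_const.sub continuous_id).tendsto g).mono_left nhdsWithin_le_nhds
    refine ⟨true, ht, ?_⟩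
    filter_upwards [key, ht.eventually_const_lt (show 1 / 3 < 1 - g by linarith)] with β h1 h2
    exact ⟨h1.2.1, h2, h1.2.2⟩
  | succ n ih =>
    obtain ⟨b, ht, hev⟩ := ih
    have key : ∀ᶠ β in 𝓝[>] g, 3 - 1 / orb b (n + 1) β = orb (!b) (n + 2) β ∧
        orb b (n + 2) β = -orb (!b) (n + 2) β ∧ orb (!b) (n + 2) β < 1 - β := by
      filter_upwards [hmem, hev] with β hβ h
      have hβ' : β ∈ Ioo g 1 := ⟨hβ.1, by linarith [hβ.2]⟩
      obtain ⟨h1, h2, h3⟩ := T_near_one_sub_g hβ' (w := orb b (n + 1) β) ⟨h.2.1, h.2.2.le⟩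
      rw [orb_succ (!b) (n + 1), orb_succ b (n + 1), h.1, h2, h3]
      exact ⟨rfl, by ring, h1.2⟩
    have ht' : Tendsto (orb (!b) (n + 2)) (𝓝[>] g) (𝓝 (1 - g)) :=
      (tendsto_three_sub ht).congr' (key.mono fun β h => h.1)
    refine ⟨!b, ht', ?_⟩
    filter_upwards [key, ht'.eventually_const_lt (show 1 / 3 < 1 - g by linarith)] with β h1 h2
    rw [Bool.not_not]
    exact ⟨h1.2.1, h2, h1.2.2⟩

lemma eventually_not_exits_near_g (n : ℕ) : ∀ᶠ β in 𝓝[>] g, ¬ Exits β n := by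
  have hg := g_gt
  have hmem : ∀ᶠ β in 𝓝[>] g, β ∈ Ioo g 1 := Ioo_mem_nhdsGT (by linarith [g_lt])
  cases n with
  | zero => exact hmem.mono fun β hβ => not_exits_zero hβ
  | succ n =>
    obtain ⟨b, -, hev⟩ := eventually_orb_near_g n
    filter_upwards [hmem, hev] with β h1 h2
    obtain ⟨b1, b2, -⟩ := bounds h1
    rintro ⟨c, hc⟩
    obtain rfl | rfl : c = b ∨ c = !b := by cases b <;> cases c <;> simp
    · linarith [h2.2.2]
    · rw [h2.1] at hc
      linarith [h2.2.1, h1.2]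

lemma g_not_mem_matchingSet : g ∉ MatchingSet := by
  rintro ⟨J, M, N, hJ, hgJ⟩
  have hopen : IsOpen J := by
    obtain ⟨⟨a, b, -, rfl⟩, -⟩ := hJ
    exact isOpen_Ioo
  have hmem : ∀ᶠ β in 𝓝[>] g, β ∈ Ioo g 1 := Ioo_mem_nhdsGT (by linarith [g_lt])
  have hJmem : ∀ᶠ β in 𝓝[>] g, β ∈ J := nhdsWithin_le_nhds (hopen.mem_nhds hgJ)
  obtain ⟨β, h1, ⟨h2, h3⟩, h4⟩ := ((frequently_of_ae (ae_firstExit hJ) g).1.and_eventually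
    ((hmem.and hJmem).and (eventually_not_exits_near_g (min M (N - 1) - 1)))).exists
  exact h4 (h1 ⟨h3, h2⟩).1

lemma one_not_mem_matchingSet : (1 : ℝ) ∉ MatchingSet := by
  rintro ⟨J, M, N, ⟨⟨a, b, -, rfl⟩, hsub, -⟩, h1⟩
  obtain ⟨z, hz, hz'⟩ := exists_between h1.2
  have := hsub ⟨h1.1.trans hz, hz'⟩
  linarith [this.2]

lemma g_mem_Etilde : g ∈ Etilde := by
  have hg := g_gt
  have hg' := g_lt
  have h1 : 1 / (g + 1) = g := by
    have : g + 1 ≠ 0 := by linarith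
    field_simp
    linarith [g_sq]
  have h2 : ∀ n ≥ 1, ∀ x, (T g)^[n] x ≤ g := by
    intro n hn x
    obtain ⟨m, rfl⟩ := Nat.exists_eq_add_of_le' hn
    rw [Function.iterate_succ_apply']
    exact (T_mem (by linarith) (by linarith) _).2.le
  refine ⟨⟨le_rfl, by linarith⟩, fun n hn => ?_⟩
  rw [h1]
  exact ⟨h2 n hn _, h2 n hn _⟩

lemma one_mem_Etilde : (1 : ℝ) ∈ Etilde := by
  have h2 : ∀ n, (T 1)^[n] 0 = 0 := fun n => Function.iterate_fixed (T_zero 1) n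
  refine ⟨⟨by linarith [g_lt], le_rfl⟩, fun n _ => ?_⟩
  norm_num [h2]

lemma mem_Etilde_iff {α : ℝ} (hα : α ∈ Ioo g 1) : α ∈ Etilde ↔ ∀ n, ¬ Exits α n := by
  constructor
  · intro h n
    rcases n.eq_zero_or_pos with rfl | hn
    · exact not_exits_zero hα
    · rintro ⟨b, hb⟩
      cases b
      · exact hb.not_ge (h.2 n hn).2
      · exact hb.not_ge (h.2 n hn).1
  · exact fun h => ⟨⟨hα.1.le, hα.2.le⟩, fun n _ =>
      ⟨le_of_not_exits (h n) true, le_of_not_exits (h n) false⟩⟩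

lemma mem_matchingSet_iff {α : ℝ} (hα : α ∈ Ioo g 1) : α ∈ MatchingSet ↔ α ∉ Etilde := by
  classical
  rw [mem_Etilde_iff hα]
  refine ⟨fun h hex => not_mem_matchingSet hα hex h, fun h => ?_⟩
  push Not at h
  exact mem_matchingSet_of_firstExit hα ⟨Nat.find_spec h, fun i hi => Nat.find_min h hi⟩

end TanakaIto

theorem stmt8 : E ∩ Set.Icc g 1 = Etilde := by
  ext α
  have hE : α ∈ Icc g 1 → (α ∈ E ↔ α ∉ MatchingSet) := fun h =>
    ⟨fun h' => h'.2, fun h' => ⟨⟨by linarith [TanakaIto.g_gt, h.1], h.2⟩, h'⟩⟩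
  have key : α ∈ Icc g 1 → (α ∉ MatchingSet ↔ α ∈ Etilde) := by
    intro h
    rcases h.1.eq_or_lt with rfl | hg
    · exact iff_of_true TanakaIto.g_not_mem_matchingSet TanakaIto.g_mem_Etilde
    rcases h.2.eq_or_lt with rfl | h1
    · exact iff_of_true TanakaIto.one_not_mem_matchingSet TanakaIto.one_mem_Etilde
    · rw [TanakaIto.mem_matchingSet_iff ⟨hg, h1⟩, not_not]
  exact ⟨fun h => (key h.2).1 ((hE h.2).1 h.1), fun h => ⟨(hE h.1).2 ((key h.1).2 h), h.1⟩⟩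
end

section
/- The matching set (the union of all matching intervals) has full Lebesgue measure in [0,1]. Moreover, every matching interval has matching index in {−2, 0, 2}; more precisely, every matching interval intersecting [0, 1/2) has matching index 0 or 2, and every matching interval intersecting (1/2, 1] has matching index 0 or −2. -/
open Set Filter MeasureTheory

open Topology

/-- The Gauss map of regular continued fractions. -/
noncomputable def gaussMap (x : ℝ) : ℝ := Int.fract x⁻¹

lemma Irrational.gaussMap {x : ℝ} (hx : Irrational x) : Irrational (gaussMap x) := by
  have : _root_.gaussMap x = x⁻¹ - (⌊x⁻¹⌋ : ℤ) := rfl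
  rw [this]
  exact hx.inv.sub_intCast _

lemma Irrational.gaussMap_pos {x : ℝ} (hx : Irrational x) : 0 < _root_.gaussMap x :=
  lt_of_le_of_ne (Int.fract_nonneg _) (Ne.symm hx.gaussMap.ne_zero)

lemma gaussMap_lt_one (x : ℝ) : gaussMap x < 1 := Int.fract_lt_one _

lemma gaussMap_inv_natCast_add {a : ℕ} {s : ℝ} (hs : s ∈ Ioo (0 : ℝ) 1) :
    gaussMap (1 / (a + s)) = s := by
  rw [gaussMap, one_div, inv_inv, Int.fract_natCast_add, Int.fract_eq_self]
  exact ⟨hs.1.le, hs.2⟩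

lemma gaussMap_iterate_irrational {x : ℝ} (hx : Irrational x) (h : x ∈ Ioo (0 : ℝ) 1) (n : ℕ) :
    Irrational (gaussMap^[n] x) ∧ gaussMap^[n] x ∈ Ioo (0 : ℝ) 1 := by
  induction n with
  | zero => exact ⟨hx, h⟩
  | succ n ih =>
    rw [Function.iterate_succ_apply']
    exact ⟨ih.1.gaussMap, ih.1.gaussMap_pos, gaussMap_lt_one _⟩

/-- Every irrational point of the unit interval lies in the image of an inverse branch of each
iterate of the Gauss map, which is a Möbius map with controlled coefficients. -/
lemma exists_gaussMap_inverse_branch {x : ℝ} (hx : Irrational x) (h : x ∈ Ioo (0 : ℝ) 1) (n : ℕ) :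
    ∃ p p' q q' : ℝ, 1 ≤ q ∧ 0 ≤ q' ∧ q' ≤ q ∧ (n : ℝ) ≤ q ∧ (1 ≤ n → 1 ≤ q') ∧
      |p' * q - p * q'| = 1 ∧
      x = (p + gaussMap^[n] x * p') / (q + gaussMap^[n] x * q') ∧
      ∀ s ∈ Ioo (0 : ℝ) 1, gaussMap^[n] ((p + s * p') / (q + s * q')) = s := by
  induction n with
  | zero => exact ⟨0, 1, 1, 0, by simp⟩
  | succ n ih =>
    obtain ⟨p, p', q, q', h1, h2, h3, h4, h5, h6, h7, h8⟩ := ih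
    obtain ⟨hsi, hs⟩ := gaussMap_iterate_irrational hx h n
    obtain ⟨hsi', hs'⟩ := gaussMap_iterate_irrational hx h (n + 1)
    set s := gaussMap^[n] x with hsdef
    obtain ⟨a, ha⟩ : ∃ a : ℕ, s⁻¹ = a + gaussMap^[n + 1] x := by
      refine ⟨⌊s⁻¹⌋₊, ?_⟩
      rw [Function.iterate_succ_apply', ← hsdef, gaussMap,
        natCast_floor_eq_intCast_floor (inv_pos.2 hs.1).le, Int.floor_add_fract]
    have hsa : s = 1 / (a + gaussMap^[n + 1] x) := by rw [← ha, one_div, inv_inv]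
    have ha1 : (1 : ℝ) ≤ a := by
      have h1s : 1 < s⁻¹ := (one_lt_inv₀ hs.1).2 hs.2
      have : (0 : ℝ) < a := by linarith [hs'.2]
      exact_mod_cast this
    have key : ∀ t ∈ Ioo (0 : ℝ) 1, ((a * p + p') + t * p) / ((a * q + q') + t * q) =
        (p + 1 / (a + t) * p') / (q + 1 / (a + t) * q') := by
      intro t ht
      have : 0 < a + t := by linarith [ht.1]
      have : 0 < q + 1 / (a + t) * q' := by positivity
      have : 0 < a * q + q' + t * q := by nlinarith [ht.1]
      field_simp
      ring
    refine ⟨a * p + p', p, a * q + q', q, by nlinarith, by linarith, by nlinarith, ?_,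
      fun _ => h1, ?_, ?_, ?_⟩
    · push_cast
      rcases Nat.eq_zero_or_pos n with h0 | h0
      · subst h0; simp; nlinarith
      · nlinarith [h5 h0]
    · rw [← h6, ← abs_neg]; congr 1; ring
    · rw [key _ hs', ← hsa]; exact h7
    · intro t ht
      have hat : 1 < a + t := by linarith [ht.1]
      rw [Function.iterate_succ_apply', key t ht, h8 _ ⟨by positivity, ?_⟩,
        gaussMap_inv_natCast_add ht]
      rw [div_lt_one (by linarith)]; exact hat

lemma measurable_gaussMap_iterate (n : ℕ) : Measurable gaussMap^[n] :=
  Measurable.iterate (measurable_fract.comp measurable_inv) n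

/-- For a fixed subinterval of `[0, 1]`, almost every Gauss orbit visits it. -/
lemma ae_exists_gaussMap_iterate_mem {c d : ℝ} (hc : 0 ≤ c) (hcd : c < d) (hd : d ≤ 1) :
    ∀ᵐ x : ℝ, Irrational x → x ∈ Ioo (0 : ℝ) 1 → ∃ n, gaussMap^[n] x ∈ Ioo c d := by
  set E : Set ℝ := {x | Irrational x} ∩ Ioo (0 : ℝ) 1 ∩ ⋂ n, (gaussMap^[n]) ⁻¹' (Ioo c d)ᶜ with hE
  suffices hE0 : volume E = 0 by
    filter_upwards [measure_eq_zero_iff_ae_notMem.1 hE0] with x hx hxi hx1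
    by_contra! hcon
    exact hx ⟨⟨hxi, hx1⟩, mem_iInter.2 hcon⟩
  have hEm : MeasurableSet E :=
    (IsGδ.setOfPred_irrational.measurableSet.inter measurableSet_Ioo).inter
      (MeasurableSet.iInter fun n => measurable_gaussMap_iterate n measurableSet_Ioo.compl)
  have hdens := IsUnifLocDoublingMeasure.ae_tendsto_measure_inter_div (volume : Measure ℝ) E 1
  rw [← Measure.restrict_eq_zero, ← ae_eq_bot, ← eventually_false_iff_eq_bot]
  filter_upwards [hdens, ae_restrict_mem hEm] with x hx hxE
  choose p p' q q' h1 h2 h3 h4 h5 h6 h7 h8 using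
    exists_gaussMap_inverse_branch hxE.1.1 hxE.1.2
  set φ : ℕ → ℝ → ℝ := fun n s => (p n + s * p' n) / (q n + s * q' n) with hφ
  have hden : ∀ n, ∀ s : ℝ, 0 ≤ s → 0 < q n + s * q' n := fun n s hs => by
    nlinarith [h1 n, mul_nonneg hs (h2 n)]
  have hsub : ∀ n, ∀ s t : ℝ, 0 ≤ s → 0 ≤ t → φ n s - φ n t =
      (s - t) * (p' n * q n - p n * q' n) / ((q n + s * q' n) * (q n + t * q' n)) := by
    intro n s t hs ht
    simp only [hφ]
    rw [div_sub_div _ _ (hden n s hs).ne' (hden n t ht).ne']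
    congr 1
    ring
  have habs : ∀ n, ∀ s t : ℝ, 0 ≤ s → 0 ≤ t → |φ n s - φ n t| =
      |s - t| / ((q n + s * q' n) * (q n + t * q' n)) := by
    intro n s t hs ht
    rw [hsub n s t hs ht, abs_div, abs_mul, h6, mul_one,
      abs_of_pos (mul_pos (hden n s hs) (hden n t ht))]
  set w : ℕ → ℝ := fun n => (φ n 0 + φ n 1) / 2 with hw
  set δ : ℕ → ℝ := fun n => |φ n 1 - φ n 0| / 2 with hδ
  have hδ' : ∀ n, δ n = 1 / (q n * (q n + q' n)) / 2 := fun n => by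
    simp only [hδ]
    rw [habs n 1 0 zero_le_one le_rfl]
    simp [mul_comm]
  have hball : ∀ n, ∀ s ∈ Icc (0 : ℝ) 1, φ n s ∈ Metric.closedBall (w n) (δ n) := by
    intro n s hs
    have hprod : 0 ≤ (φ n s - φ n 0) * (φ n 1 - φ n s) := by
      rw [hsub n s 0 hs.1 le_rfl, hsub n 1 s zero_le_one hs.1, div_mul_div_comm]
      have e0 := hden n 0 le_rfl
      have e1 := hden n 1 zero_le_one
      have e2 := hden n s hs.1
      apply div_nonneg _ (by positivity)
      have := mul_nonneg (mul_nonneg hs.1 (sub_nonneg.2 hs.2))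
        (sq_nonneg (p' n * q n - p n * q' n))
      nlinarith
    rw [Metric.mem_closedBall, Real.dist_eq]
    simp only [hδ, hw]
    rw [← abs_of_pos (zero_lt_two (α := ℝ)), ← abs_div, ← sq_le_sq, abs_of_pos zero_lt_two]
    nlinarith
  have hδpos : ∀ n, 0 < δ n := fun n => by
    rw [hδ']
    have := h1 n
    have := h2 n
    positivity
  have hδlim : Tendsto δ atTop (𝓝[>] 0) := by
    apply tendsto_nhdsWithin_iff.2 ⟨?_, Eventually.of_forall hδpos⟩
    refine squeeze_zero (fun n => (hδpos n).le) (fun n => ?_) tendsto_one_div_add_atTop_nhds_zero_nat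
    rw [hδ', div_div]
    apply one_div_le_one_div_of_le (by positivity)
    nlinarith [h1 n, h2 n, h4 n]
  have hxball : ∀ n, x ∈ Metric.closedBall (w n) (1 * δ n) := by
    intro n
    obtain ⟨-, hs⟩ := gaussMap_iterate_irrational hxE.1.1 hxE.1.2 n
    have := hball n _ (Ioo_subset_Icc_self hs)
    rw [one_mul]
    convert this
    exact h7 n
  have hlim := hx w δ hδlim (Eventually.of_forall hxball)
  have hbound : ∀ n, volume (E ∩ Metric.closedBall (w n) (δ n)) /
      volume (Metric.closedBall (w n) (δ n)) ≤ ENNReal.ofReal (1 - (d - c) / 2) := by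
    intro n
    have hIcc : Icc c d ⊆ Icc 0 1 := Icc_subset_Icc hc hd
    have hgapsub : uIoo (φ n c) (φ n d) ⊆ Metric.closedBall (w n) (δ n) := by
      rw [Real.closedBall_eq_Icc]
      refine uIoo_subset_uIcc_self.trans (uIcc_subset_Icc ?_ ?_) <;> rw [← Real.closedBall_eq_Icc]
      · exact hball n c (hIcc (left_mem_Icc.2 hcd.le))
      · exact hball n d (hIcc (right_mem_Icc.2 hcd.le))
    have hcont : ContinuousOn (φ n) (Icc c d) := by
      apply ContinuousOn.div (by fun_prop) (by fun_prop)
      exact fun s hs => (hden n s (hIcc hs).1).ne'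
    have himage : uIoo (φ n c) (φ n d) ⊆ φ n '' Ioo c d := by
      rcases le_total (φ n c) (φ n d) with h | h
      · rw [uIoo_of_le h]; exact intermediate_value_Ioo hcd.le hcont
      · rw [uIoo_of_ge h]; exact intermediate_value_Ioo' hcd.le hcont
    have hdisj : E ∩ Metric.closedBall (w n) (δ n) ⊆
        Metric.closedBall (w n) (δ n) \ uIoo (φ n c) (φ n d) := by
      rintro y ⟨hyE, hyB⟩
      refine ⟨hyB, fun hy => ?_⟩
      obtain ⟨s, hs, rfl⟩ := himage hy
      apply mem_iInter.1 hyE.2 n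
      rwa [show gaussMap^[n] (φ n s) = s from h8 n s ⟨hc.trans_lt hs.1, hs.2.trans_le hd⟩]
    have hgap : (d - c) * δ n ≤ |φ n d - φ n c| := by
      rw [habs n d c (hc.trans hcd.le) hc, abs_of_pos (sub_pos.2 hcd), hδ', div_div, mul_one_div]
      have e1 := hden n d (hc.trans hcd.le)
      have e2 := hden n c hc
      apply div_le_div_of_nonneg_left (sub_pos.2 hcd).le (by positivity)
      have f1 : q n + d * q' n ≤ q n + q' n := by nlinarith [h2 n]
      have f2 : q n + c * q' n ≤ 2 * q n := by nlinarith [h2 n, h3 n]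
      calc _ ≤ (q n + q' n) * (2 * q n) := mul_le_mul f1 f2 e2.le (by linarith)
        _ = _ := by ring
    have hnonneg : 0 ≤ 1 - (d - c) / 2 := by linarith
    apply ENNReal.div_le_of_le_mul
    refine (measure_mono hdisj).trans ?_
    rw [measure_sdiff hgapsub measurableSet_Ioo.nullMeasurableSet
        (by rw [Real.volume_uIoo]; exact ENNReal.ofReal_ne_top),
      Real.volume_uIoo, Real.volume_closedBall, ← ENNReal.ofReal_sub _ (abs_nonneg _),
      ← ENNReal.ofReal_mul hnonneg]
    apply ENNReal.ofReal_le_ofReal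
    nlinarith
  have hle := le_of_tendsto' hlim hbound
  rw [ENNReal.one_le_ofReal] at hle
  linarith

/-- Almost every Gauss orbit meets every nonempty open subinterval of `[0, 1]`. -/
lemma ae_gaussMap_orbit_dense :
    ∀ᵐ x : ℝ, Irrational x → x ∈ Ioo (0 : ℝ) 1 → ∀ c d : ℝ, 0 ≤ c → c < d → d ≤ 1 →
      ∃ n, gaussMap^[n] x ∈ Ioo c d := by
  have h : ∀ᵐ x : ℝ, ∀ r : ℚ × ℚ, 0 ≤ (r.1 : ℝ) → (r.1 : ℝ) < r.2 → (r.2 : ℝ) ≤ 1 →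
      Irrational x → x ∈ Ioo (0 : ℝ) 1 → ∃ n, gaussMap^[n] x ∈ Ioo (r.1 : ℝ) r.2 := by
    rw [ae_all_iff]
    intro r
    simp only [eventually_imp_distrib_left]
    exact ae_exists_gaussMap_iterate_mem
  filter_upwards [h] with x hx hxi hx1 c d hc hcd hd
  obtain ⟨r, hr1, hr2⟩ := exists_rat_btwn hcd
  obtain ⟨r', hr1', hr2'⟩ := exists_rat_btwn hr2
  obtain ⟨n, hn⟩ := hx (r, r') (hc.trans hr1.le) hr1' (hr2'.le.trans hd) hxi hx1
  exact ⟨n, hr1.trans hn.1, hn.2.trans hr2'⟩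

lemma T_of_ne_zero {α x : ℝ} (hx : x ≠ 0) : T α x = 1 / x - (⌊1 / x + 1 - α⌋ : ℝ) := if_neg hx

lemma T_eq_of_sub_eq_intCast {α x y : ℝ} (hx : x ≠ 0) (n : ℤ) (hn : 1 / x = y + n)
    (h1 : α - 1 ≤ y) (h2 : y < α) : T α x = y := by
  have : ⌊1 / x + 1 - α⌋ = n := by
    rw [Int.floor_eq_iff]
    constructor <;> linarith
  rw [T_of_ne_zero hx, this]
  linarith

lemma T_congr {α x y : ℝ} (hx : x ≠ 0) (hy : y ≠ 0) (n : ℤ) (hn : 1 / x = 1 / y + n) :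
    T α x = T α y := by
  rw [T_of_ne_zero hx, T_of_ne_zero hy, hn,
    show 1 / y + n + 1 - α = 1 / y + 1 - α + n by ring, Int.floor_add_intCast]
  push_cast
  ring

lemma T_mem_Ico {α : ℝ} (h : α ∈ Ioo (0 : ℝ) 1) (x : ℝ) : T α x ∈ Ico (α - 1) α := by
  by_cases hx : x = 0
  · simp only [T, hx, if_true]
    exact ⟨by linarith [h.2], h.1⟩
  · rw [T_of_ne_zero hx]
    constructor
    · linarith [Int.floor_le (1 / x + 1 - α)]
    · linarith [Int.lt_floor_add_one (1 / x + 1 - α)]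

lemma gaussMap_eq (x : ℝ) : gaussMap x = 1 / x - ⌊1 / x⌋ := by
  rw [one_div]; rfl

/-- The points `p` and `q` have reciprocals congruent modulo `1` to `f` and `-f`. -/
def OppositeMod (f p q : ℝ) : Prop := ∃ m n : ℤ, 1 / p = f + m ∧ 1 / q = n - f

lemma OppositeMod.symm {f p q : ℝ} (h : OppositeMod f p q) : OppositeMod (1 - f) q p := by
  obtain ⟨m, n, hm, hn⟩ := h
  refine ⟨n - 1, m + 1, ?_, ?_⟩ <;> push_cast <;> linarith

lemma OppositeMod.ne_zero_left {f p q : ℝ} (h : OppositeMod f p q) (hf : f ∈ Ioo (0 : ℝ) 1) :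
    p ≠ 0 := by
  rintro rfl
  obtain ⟨m, n, hm, -⟩ := h
  rw [div_zero] at hm
  have h1 : (m : ℝ) < 0 := by linarith [hf.1]
  have h2 : (-1 : ℝ) < m := by linarith [hf.2]
  norm_cast at h1 h2
  lia

lemma OppositeMod.ne_zero_right {f p q : ℝ} (h : OppositeMod f p q) (hf : f ∈ Ioo (0 : ℝ) 1) :
    q ≠ 0 :=
  h.symm.ne_zero_left ⟨by linarith [hf.2], by linarith [hf.1]⟩

section Step

variable {α f p q : ℝ}

lemma OppositeMod.of_lt (hα : α < 1 / 2) (h : OppositeMod f p q) (hf0 : 0 < f) (hf : f < α) :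
    OppositeMod (gaussMap f) (T α p) (T α q) := by
  have hf1 : f ∈ Ioo (0 : ℝ) 1 := ⟨hf0, by linarith⟩
  have hp := h.ne_zero_left hf1
  have hq := h.ne_zero_right hf1
  obtain ⟨m, n, hm, hn⟩ := h
  rw [T_eq_of_sub_eq_intCast hp m hm (by linarith) hf,
    T_eq_of_sub_eq_intCast (y := -f) hq n (by linarith) (by linarith) (by linarith)]
  refine ⟨⌊1 / f⌋, -⌊1 / f⌋, by rw [gaussMap_eq]; ring, ?_⟩
  rw [gaussMap_eq, one_div_neg_eq_neg_one_div]
  push_cast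
  ring

lemma OppositeMod.T_of_le (hα0 : 0 < α) (hα : α < 1 / 2) (h : OppositeMod f p q)
    (hf0 : α ≤ f) (hf : f < 1 / 2) : T α p = f - 1 ∧ T α q = -f := by
  have hf1 : f ∈ Ioo (0 : ℝ) 1 := ⟨by linarith, by linarith⟩
  have hp := h.ne_zero_left hf1
  have hq := h.ne_zero_right hf1
  obtain ⟨m, n, hm, hn⟩ := h
  exact ⟨T_eq_of_sub_eq_intCast hp (m + 1) (by push_cast; linarith) (by linarith) (by linarith),
    T_eq_of_sub_eq_intCast hq n (by linarith) (by linarith) (by linarith)⟩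

lemma OppositeMod.matching (hα0 : 0 < α) (hα : α < 1 / 2)
    (h : OppositeMod f p q) (hf0 : α ≤ f) (hf : f < 1 / 2) (hf1 : f / (1 - f) ≤ 1 - α) :
    (T α)^[3] p = (T α)^[2] q := by
  obtain ⟨h1, h2⟩ := h.T_of_le hα0 hα hf0 hf
  have hfpos : 0 < f := by linarith
  have hf' : 0 < 1 - f := by linarith
  have hpos : 0 < f / (1 - f) := by positivity
  have h3 : T α (f - 1) = -(f / (1 - f)) := by
    refine T_eq_of_sub_eq_intCast (by linarith) (-1) ?_ (by linarith) (by linarith)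
    have : f - 1 ≠ 0 := by linarith
    push_cast
    field_simp
    ring
  change T α (T α (T α p)) = T α (T α q)
  rw [h1, h2, h3]
  refine T_congr (by linarith) (by linarith) 1 ?_
  push_cast
  field_simp
  ring

lemma OppositeMod.of_gt (hα0 : 0 < α) (hα : α < 1 / 2) (hα' : 0 < α ^ 2 - 3 * α + 1)
    (h : OppositeMod f p q) (hf0 : α ≤ f) (hf : f < 1 / 2) (hf1 : 1 - α < f / (1 - f)) :
    OppositeMod (gaussMap (gaussMap f)) (T α (T α p)) (T α (T α q)) := by
  obtain ⟨h1, h2⟩ := h.T_of_le hα0 hα hf0 hf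
  have hfpos : 0 < f := by linarith
  have hf' : 0 < 1 - f := by linarith
  rw [lt_div_iff₀ hf'] at hf1
  have hfge : 1 / 3 < f := by nlinarith
  have hinv : 1 / f < 3 := by rw [div_lt_iff₀ hfpos]; linarith
  have hinv' : 2 < 1 / f := by rw [lt_div_iff₀ hfpos]; linarith
  have hinv'' : 1 / f - 2 ≤ 1 - α := by
    rw [sub_le_iff_le_add, div_le_iff₀ hfpos]
    nlinarith
  have hg : gaussMap f = 1 / f - 2 := by
    rw [gaussMap_eq, show ⌊1 / f⌋ = 2 by rw [Int.floor_eq_iff]; constructor <;> push_cast <;> linarith]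
    norm_num
  set s := gaussMap f with hs
  have hspos : 0 < s := by linarith
  have hfs : f = 1 / (s + 2) := by rw [hg]; simp
  have h3 : T α (f - 1) = 1 - f / (1 - f) := by
    have e : (1 - α) * (1 - f) / (1 - f) = 1 - α := by field_simp
    refine T_eq_of_sub_eq_intCast (by linarith) (-2) ?_ ?_ ?_
    · have : f - 1 ≠ 0 := by linarith
      push_cast
      field_simp
      ring
    · have : f / (1 - f) ≤ 1 := by rw [div_le_one hf']; linarith
      linarith
    · have : 1 - α < f / (1 - f) := by rwa [lt_div_iff₀ hf']
      linarith
  have h4 : T α (-f) = -s := by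
    refine T_eq_of_sub_eq_intCast (by linarith) (-2) ?_ (by linarith) (by linarith)
    rw [one_div_neg_eq_neg_one_div]
    push_cast
    linarith
  rw [h1, h2, h3, h4]
  refine ⟨⌊1 / s⌋ + 1, -⌊1 / s⌋, ?_, ?_⟩
  · rw [gaussMap_eq s, hfs]
    push_cast
    have : 1 - 1 / (s + 2) ≠ 0 := by rw [← hfs]; exact hf'.ne'
    have e : 1 - 1 / (s + 2) / (1 - 1 / (s + 2)) = s / (s + 1) := by
      have : 1 - 1 / (s + 2) = (s + 1) / (s + 2) := by field_simp; ring
      rw [this]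
      field_simp
      ring
    rw [e]
    field_simp
    ring
  · rw [gaussMap_eq s, one_div_neg_eq_neg_one_div]
    push_cast
    ring

end Step

lemma gaussMap_one_sub {f : ℝ} (hf : 1 / 2 < f) (hf1 : f < 1) :
    gaussMap (1 - f) = gaussMap (gaussMap f) := by
  have hfpos : 0 < f := by linarith
  have hf' : 0 < 1 - f := by linarith
  have hg : gaussMap f = 1 / f - 1 := by
    have h1 : 1 < 1 / f := by rw [lt_div_iff₀ hfpos]; linarith
    have h2 : 1 / f < 2 := by rw [div_lt_iff₀ hfpos]; linarith
    rw [gaussMap_eq, show ⌊1 / f⌋ = 1 by rw [Int.floor_eq_iff]; constructor <;> push_cast <;> linarith]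
    norm_num
  have : (1 - f)⁻¹ = (1 / f - 1)⁻¹ + 1 := by
    have : 1 / f - 1 = (1 - f) / f := by field_simp
    rw [this]
    field_simp
    ring
  rw [hg, gaussMap, gaussMap, this, Int.fract_add_one]

/-- Matching at the single parameter `α` with matching index `0` or `2`. -/
def HasMatching (α : ℝ) : Prop :=
  ∃ M N : ℕ, (T α)^[M] (α - 1) = (T α)^[N] α ∧ (M = N ∨ M = N + 2)

/-- At some time the orbit of `α` and the shifted orbit of `α - 1` are opposite modulo `f`. -/
def OrbitsOpposite (α f : ℝ) : Prop :=
  ∃ i : ℕ, OppositeMod f ((T α)^[i] α) ((T α)^[i + 1] (α - 1)) ∨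
    OppositeMod f ((T α)^[i + 1] (α - 1)) ((T α)^[i] α)

section SmallParameter

variable {α f : ℝ}

lemma OrbitsOpposite.symm (h : OrbitsOpposite α f) : OrbitsOpposite α (1 - f) := by
  obtain ⟨i, h | h⟩ := h
  · exact ⟨i, Or.inr h.symm⟩
  · exact ⟨i, Or.inl h.symm⟩

lemma OrbitsOpposite.of_lt (hα : α < 1 / 2) (h : OrbitsOpposite α f) (hf0 : 0 < f) (hf : f < α) :
    OrbitsOpposite α (gaussMap f) := by
  obtain ⟨i, h⟩ := h
  refine ⟨i + 1, ?_⟩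
  simp only [Function.iterate_succ_apply' (T α)] at h ⊢
  exact h.imp (fun h => h.of_lt hα hf0 hf) (fun h => h.of_lt hα hf0 hf)

lemma OrbitsOpposite.of_gt (hα0 : 0 < α) (hα : α < 1 / 2) (hα' : 0 < α ^ 2 - 3 * α + 1)
    (h : OrbitsOpposite α f) (hf0 : α ≤ f) (hf : f < 1 / 2) (hf1 : 1 - α < f / (1 - f)) :
    OrbitsOpposite α (gaussMap (gaussMap f)) := by
  obtain ⟨i, h⟩ := h
  refine ⟨i + 2, ?_⟩
  simp only [Function.iterate_succ_apply' (T α)] at h ⊢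
  exact h.imp (fun h => h.of_gt hα0 hα hα' hf0 hf hf1) (fun h => h.of_gt hα0 hα hα' hf0 hf hf1)

lemma OrbitsOpposite.hasMatching (hα0 : 0 < α) (hα : α < 1 / 2)
    (h : OrbitsOpposite α f) (hf0 : α ≤ f) (hf : f < 1 / 2) (hf1 : f / (1 - f) ≤ 1 - α) :
    HasMatching α := by
  obtain ⟨i, h | h⟩ := h
  · refine ⟨2 + (i + 1), 3 + i, ?_, Or.inl (by ring)⟩
    rw [Function.iterate_add_apply, Function.iterate_add_apply _ 3]
    exact (h.matching hα0 hα hf0 hf hf1).symm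
  · refine ⟨3 + (i + 1), 2 + i, ?_, Or.inr (by ring)⟩
    rw [Function.iterate_add_apply, Function.iterate_add_apply _ 2]
    exact h.matching hα0 hα hf0 hf hf1

lemma OrbitsOpposite.step (hα0 : 0 < α) (hα : α < 1 / 2) (hα' : 0 < α ^ 2 - 3 * α + 1)
    (h : OrbitsOpposite α f) (hf0 : 0 < f) (hf : f < 1 / 2) :
    HasMatching α ∨ OrbitsOpposite α (gaussMap f) ∨ OrbitsOpposite α (gaussMap (gaussMap f)) := by
  rcases lt_or_ge f α with h1 | h1
  · exact Or.inr (Or.inl (h.of_lt hα hf0 h1))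
  · rcases le_or_gt (f / (1 - f)) (1 - α) with h2 | h2
    · exact Or.inl (h.hasMatching hα0 hα h1 hf h2)
    · exact Or.inr (Or.inr (h.of_gt hα0 hα hα' h1 hf h2))

lemma orbitsOpposite_gaussMap (hα0 : 0 < α) (hα : α < 1 / 2) (hα' : 0 < α ^ 2 - 3 * α + 1) :
    OrbitsOpposite α (gaussMap α) := by
  have hα1 : 0 < 1 - α := by linarith
  have h1 : α / (1 - α) ≤ 1 - α := by rw [div_le_iff₀ hα1]; nlinarith
  have hpos : 0 < α / (1 - α) := by positivity
  have h2 : T α (α - 1) = -(α / (1 - α)) := by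
    refine T_eq_of_sub_eq_intCast (by linarith) (-1) ?_ (by linarith) (by linarith)
    have : α - 1 ≠ 0 := by linarith
    push_cast
    field_simp
    ring
  refine ⟨0, Or.inl ⟨⌊1 / α⌋, 1 - ⌊1 / α⌋, ?_, ?_⟩⟩
  · rw [gaussMap_eq]
    simp
  · change 1 / T α (α - 1) = _
    rw [h2, gaussMap_eq]
    push_cast
    field_simp
    ring

lemma hasMatching_or_orbitsOpposite (hα0 : 0 < α) (hα : α < 1 / 2)
    (hα' : 0 < α ^ 2 - 3 * α + 1) (hirr : Irrational α) (m : ℕ) (hm : 1 ≤ m) :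
    HasMatching α ∨ OrbitsOpposite α (gaussMap^[m] α) ∨ OrbitsOpposite α (gaussMap^[m + 1] α) ∨
      OrbitsOpposite α (gaussMap^[m + 2] α) := by
  induction m, hm using Nat.le_induction with
  | base => exact Or.inr (Or.inl (orbitsOpposite_gaussMap hα0 hα hα'))
  | succ m hm ih =>
    rcases ih with h | h | h | h
    · exact Or.inl h
    · obtain ⟨hi, h0, h1⟩ := gaussMap_iterate_irrational hirr ⟨hα0, by linarith⟩ m
      have hne : gaussMap^[m] α ≠ 1 / 2 := by
        intro h
        exact hi ⟨1 / 2, by rw [h]; norm_num⟩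
      simp only [Function.iterate_succ_apply' gaussMap] at h ⊢
      rcases lt_or_gt_of_ne hne with h2 | h2
      · rcases h.step hα0 hα hα' h0 h2 with h | h | h <;> simp [h]
      · have := h.symm.step hα0 hα hα' (by linarith) (by linarith)
        rw [gaussMap_one_sub h2 h1] at this
        rcases this with h | h | h <;> simp [h]
    · exact Or.inr (Or.inl h)
    · exact Or.inr (Or.inr (Or.inl h))

lemma gaussMap_mem_Ioo {K : ℕ} (hK : 0 < K) {c d y : ℝ} (hc : 0 ≤ c) (hd : d ≤ 1)
    (hy : y ∈ Ioo (1 / (K + d)) (1 / (K + c))) (hcd : c < d) :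
    gaussMap y ∈ Ioo c d ∧ 0 < y ∧ y < 1 / K := by
  have hK' : (0 : ℝ) < K := by exact_mod_cast hK
  have hcpos : 0 < K + c := by linarith
  have hdpos : 0 < K + d := by linarith
  have hy0 : 0 < y := lt_trans (by positivity) hy.1
  have h1 : K + c < 1 / y := by
    rw [lt_div_iff₀ hy0, ← lt_div_iff₀' hcpos]; exact hy.2
  have h2 : 1 / y < K + d := by
    rw [div_lt_iff₀ hy0, ← div_lt_iff₀' hdpos]; exact hy.1
  have hfl : ⌊1 / y⌋ = K := by
    rw [Int.floor_eq_iff]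
    constructor <;> push_cast <;> linarith
  refine ⟨?_, hy0, hy.2.trans_le (one_div_le_one_div_of_le hK' (by linarith))⟩
  rw [gaussMap_eq, hfl]
  push_cast
  constructor <;> linarith

lemma hasMatching_of_dense_orbit (hα0 : 0 < α) (hα : α < 1 / 2) (hα' : 0 < α ^ 2 - 3 * α + 1)
    (hirr : Irrational α) (hdense : ∀ c d : ℝ, 0 ≤ c → c < d → d ≤ 1 →
      ∃ n, gaussMap^[n] α ∈ Ioo c d) : HasMatching α := by
  obtain ⟨K, hK⟩ := exists_nat_gt (1 / α)
  have hKpos : (0 : ℝ) < K := lt_trans (by positivity) hK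
  have hK0 : 0 < K := by exact_mod_cast hKpos
  have hK1 : (1 : ℝ) ≤ K := by exact_mod_cast hK0
  have hKα : 1 / (K : ℝ) < α := by
    rw [div_lt_iff₀ hKpos]
    rwa [div_lt_iff₀ hα0, mul_comm] at hK
  have hα2 : 0 < 2 - α := by linarith
  set d := (1 - α) / (2 - α) with hd
  have hαd : α < d := by rw [hd, lt_div_iff₀ hα2]; nlinarith
  have hd1 : d < 1 / 2 := by rw [hd, div_lt_iff₀ hα2]; linarith
  have shift : ∀ c d : ℝ, 0 ≤ c → c < d →
      0 ≤ 1 / (K + d) ∧ 1 / (K + d) < 1 / (K + c) ∧ 1 / (K + c) ≤ 1 := by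
    intro c d hc hcd
    have : 0 < K + c := by linarith
    have : 0 < K + d := by linarith
    exact ⟨by positivity, one_div_lt_one_div_of_lt (by linarith) (by linarith),
      by rw [div_le_one (by linarith)]; linarith⟩
  obtain ⟨a1, b1, c1⟩ := shift α d hα0.le hαd
  obtain ⟨a2, b2, c2⟩ := shift _ _ a1 b1
  obtain ⟨a3, b3, c3⟩ := shift _ _ a2 b2
  obtain ⟨m, hm⟩ := hdense _ _ a3 b3 c3
  obtain ⟨hm1, p0, l0⟩ := gaussMap_mem_Ioo hK0 a2 c2 hm b2
  obtain ⟨hm2, p1, l1⟩ := gaussMap_mem_Ioo hK0 a1 c1 hm1 b1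
  obtain ⟨hm3, p2, l2⟩ := gaussMap_mem_Ioo hK0 hα0.le (by linarith) hm2 hαd
  have hm0 : 1 ≤ m := by
    rcases Nat.eq_zero_or_pos m with h | h
    · subst h
      simp only [Function.iterate_zero, id] at l0
      linarith
    · exact h
  have hfinal : HasMatching α ∨ OrbitsOpposite α (gaussMap^[m + 3] α) := by
    have h := hasMatching_or_orbitsOpposite hα0 hα hα' hirr m hm0
    simp only [Function.iterate_succ_apply' gaussMap] at h ⊢
    have s2 := fun h : OrbitsOpposite α (gaussMap (gaussMap (gaussMap^[m] α))) =>
      h.of_lt hα p2 (l2.trans hKα)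
    have s1 := fun h : OrbitsOpposite α (gaussMap (gaussMap^[m] α)) =>
      s2 (h.of_lt hα p1 (l1.trans hKα))
    rcases h with h | h | h | h
    · exact Or.inl h
    · exact Or.inr (s1 (h.of_lt hα p0 (l0.trans hKα)))
    · exact Or.inr (s1 h)
    · exact Or.inr (s2 h)
  rcases hfinal with h | h
  · exact h
  · simp only [Function.iterate_succ_apply' gaussMap] at h
    refine h.hasMatching hα0 hα hm3.1.le (by linarith [hm3.2]) ?_
    have h3 := hm3.2
    rw [hd, lt_div_iff₀ hα2] at h3
    rw [div_le_iff₀ (by linarith [hm3.2])]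
    linarith

end SmallParameter

lemma hasMatching_of_large {α : ℝ} (hα : α < 1 / 2) (hα' : α ^ 2 - 3 * α + 1 < 0)
    (hne : α ^ 2 + 2 * α ≠ 1) (hne' : 5 * α - 2 ≠ 0) : HasMatching α := by
  have hα3 : 1 / 3 < α := by nlinarith
  have hα0 : 0 < α := by linarith
  have hα1 : 0 < 1 - α := by linarith
  have hα2 : 0 < 1 - 2 * α := by linarith
  have y1 : T α (α - 1) = (1 - 2 * α) / (1 - α) := by
    refine T_eq_of_sub_eq_intCast (by linarith) (-2) ?_ ?_ ?_
    · have : α - 1 ≠ 0 := by linarith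
      push_cast
      field_simp
      ring
    · have : 0 < (1 - 2 * α) / (1 - α) := by positivity
      linarith
    · rw [div_lt_iff₀ hα1]; nlinarith
  rcases lt_or_gt_of_ne hne with h | h
  · have hα4 : α < 0.415 := by nlinarith
    have hα5 : 0 < 3 * α - 1 := by linarith
    have x1 : T α α = (1 - 3 * α) / α := by
      refine T_eq_of_sub_eq_intCast hα0.ne' 3 ?_ ?_ ?_
      · push_cast
        field_simp
        ring
      · rw [le_div_iff₀ hα0]; nlinarith
      · rw [div_lt_iff₀ hα0]; nlinarith
    have y2 : T α ((1 - 2 * α) / (1 - α)) = (5 * α - 2) / (1 - 2 * α) := by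
      refine T_eq_of_sub_eq_intCast (by positivity) 3 ?_ ?_ ?_
      · push_cast
        field_simp
        ring
      · rw [le_div_iff₀ hα2]; nlinarith
      · rw [div_lt_iff₀ hα2]; nlinarith
    have x2 : T α ((1 - 3 * α) / α) = (5 * α - 2) / (3 * α - 1) := by
      have h13 : 1 - 3 * α ≠ 0 := by linarith
      refine T_eq_of_sub_eq_intCast (div_ne_zero h13 hα0.ne') (-2) ?_ ?_ ?_
      · push_cast
        rw [show 3 * α - 1 = -(1 - 3 * α) by ring, div_neg]
        field_simp
        ring
      · rw [le_div_iff₀ hα5]; nlinarith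
      · rw [div_lt_iff₀ hα5]; nlinarith
    refine ⟨3, 3, ?_, Or.inl rfl⟩
    change T α (T α (T α (α - 1))) = T α (T α (T α α))
    rw [y1, x1, y2, x2]
    refine T_congr (div_ne_zero hne' hα2.ne') (div_ne_zero hne' hα5.ne') (-1) ?_
    push_cast
    field_simp
    ring
  · have x1 : T α α = (1 - 2 * α) / α := by
      refine T_eq_of_sub_eq_intCast hα0.ne' 2 ?_ ?_ ?_
      · push_cast
        field_simp
        ring
      · rw [le_div_iff₀ hα0]; nlinarith
      · rw [div_lt_iff₀ hα0]; nlinarith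
    refine ⟨2, 2, ?_, Or.inl rfl⟩
    change T α (T α (α - 1)) = T α (T α α)
    rw [y1, x1]
    refine T_congr (by positivity) (by positivity) 1 ?_
    push_cast
    field_simp
    ring

section Transcendental

variable {α : ℝ}

lemma Transcendental.quadratic_eq_zero (hα : Transcendental ℚ α) {a b c : ℤ}
    (h : a * α ^ 2 + b * α + c = 0) : a = 0 ∧ b = 0 ∧ c = 0 := by
  have key : ∀ a b c : ℚ, Polynomial.C a * Polynomial.X ^ 2 + Polynomial.C b * Polynomial.X +
      Polynomial.C c = 0 → a = 0 ∧ b = 0 ∧ c = 0 := by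
    intro a b c this
    refine ⟨?_, ?_, ?_⟩
    · simpa [Polynomial.coeff_X, Polynomial.coeff_C] using congrArg (Polynomial.coeff · 2) this
    · simpa [Polynomial.coeff_X, Polynomial.coeff_C] using congrArg (Polynomial.coeff · 1) this
    · simpa [Polynomial.coeff_X, Polynomial.coeff_C] using congrArg (Polynomial.coeff · 0) this
  exact_mod_cast key a b c (transcendental_iff.1 hα _ (by simpa using h))

lemma Transcendental.linear_ne_zero (hα : Transcendental ℚ α) {a b c d : ℤ}
    (hdet : a * d - b * c ≠ 0) : a * α + b ≠ 0 := by
  intro h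
  obtain ⟨-, rfl, rfl⟩ := hα.quadratic_eq_zero (a := 0) (b := a) (c := b) (by simpa using h)
  simp at hdet

lemma Transcendental.T (hα : Transcendental ℚ α) (β : ℝ) : Transcendental ℚ (T β α) := by
  have h0 : α ≠ 0 := by
    rintro rfl
    exact hα isAlgebraic_zero
  rw [T_of_ne_zero h0]
  intro h
  apply hα
  have := (h.add (isAlgebraic_intCast ⌊1 / α + 1 - β⌋)).inv
  simpa using this

lemma Transcendental.T_iterate (hα : Transcendental ℚ α) (β : ℝ) (n : ℕ) :
    Transcendental ℚ ((_root_.T β)^[n] α) := by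
  induction n with
  | zero => exact hα
  | succ n ih => rw [Function.iterate_succ_apply']; exact ih.T β

lemma abs_T_iterate_lt_one (h : α ∈ Ioo (0 : ℝ) 1) {x : ℝ} (hx : |x| < 1) (n : ℕ) :
    |(T α)^[n] x| < 1 := by
  cases n with
  | zero => exact hx
  | succ n =>
    rw [Function.iterate_succ_apply']
    have := T_mem_Ico h ((T α)^[n] x)
    rw [abs_lt]
    constructor <;> linarith [this.1, this.2, h.1, h.2]

/-- The iterates of `T α` on a transcendental point are Möbius maps with decreasing
denominators. -/
lemma T_iterate_eq_moebius (h : α ∈ Ioo (0 : ℝ) 1) {z : ℝ} (hz : Transcendental ℚ z)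
    (hz1 : |z| < 1) (n : ℕ) : ∃ a b c d : ℤ, (c * z + d : ℝ) ≠ 0 ∧
      (T α)^[n] z = (a * z + b) / (c * z + d) ∧ |(c * z + d : ℝ)| ≤ 1 ∧
      (n ≠ 0 → |(c * z + d : ℝ)| < 1) := by
  induction n with
  | zero => exact ⟨1, 0, 0, 1, by simp⟩
  | succ n ih =>
    obtain ⟨a, b, c, d, h0, h1, h2, -⟩ := ih
    have hx := (hz.T_iterate α n)
    have hx0 : (T α)^[n] z ≠ 0 := fun h => hx (h ▸ isAlgebraic_zero)
    have hx1 := abs_T_iterate_lt_one h hz1 n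
    have hnum : (a * z + b : ℝ) = (T α)^[n] z * (c * z + d) := by
      rw [h1, div_mul_cancel₀ _ h0]
    have hnum0 : (a * z + b : ℝ) ≠ 0 := by rw [hnum]; exact mul_ne_zero hx0 h0
    have hlt : |(a * z + b : ℝ)| < 1 := by
      rw [hnum, abs_mul]
      have := abs_pos.2 h0
      nlinarith [abs_nonneg ((T α)^[n] z)]
    refine ⟨c - ⌊1 / (T α)^[n] z + 1 - α⌋ * a, d - ⌊1 / (T α)^[n] z + 1 - α⌋ * b, a, b, hnum0,
      ?_, hlt.le, fun _ => hlt⟩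
    rw [Function.iterate_succ_apply', T_of_ne_zero hx0]
    generalize ⌊1 / (T α)^[n] z + 1 - α⌋ = k
    rw [h1, one_div_div]
    push_cast
    rw [eq_div_iff hnum0, sub_mul, div_mul_cancel₀ _ hnum0]
    ring

lemma T_iterate_ne_self (h : α ∈ Ioo (0 : ℝ) 1) {z : ℝ} (hz : Transcendental ℚ z)
    (hz1 : |z| < 1) {n : ℕ} (hn : n ≠ 0) : (T α)^[n] z ≠ z := by
  intro heq
  obtain ⟨a, b, c, d, h0, h1, -, h2⟩ := T_iterate_eq_moebius h hz hz1 n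
  rw [heq, eq_div_iff h0] at h1
  obtain ⟨rfl, -, -⟩ := hz.quadratic_eq_zero (a := c) (b := d - a) (c := -b)
    (by push_cast; linarith)
  have h3 := h2 hn
  simp only [Int.cast_zero, zero_mul, zero_add, ne_eq, Int.cast_eq_zero] at h3 h0
  rw [← Int.cast_abs] at h3
  have h4 : |d| < 1 := by exact_mod_cast h3
  exact h0 (Int.abs_lt_one_iff.1 h4)

lemma T_iterate_injective (h : α ∈ Ioo (0 : ℝ) 1) {z : ℝ} (hz : Transcendental ℚ z)
    (hz1 : |z| < 1) : Function.Injective fun n => (T α)^[n] z := by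
  have key : ∀ m k : ℕ, (T α)^[m] z = (T α)^[m + k] z → k = 0 := by
    intro m k heq
    by_contra hk
    rw [add_comm, Function.iterate_add_apply] at heq
    exact T_iterate_ne_self h (hz.T_iterate α m) (abs_T_iterate_lt_one h hz1 m) hk heq.symm
  intro m n hmn
  rcases le_total m n with hle | hle <;> obtain ⟨k, rfl⟩ := Nat.exists_eq_add_of_le hle
  · rw [key m k hmn, add_zero]
  · rw [key n k hmn.symm, add_zero]

/-- The matching index at a transcendental parameter is unique. -/
lemma matching_index_unique (h : α ∈ Ioo (0 : ℝ) 1) (hα : Transcendental ℚ α) {M N M' N' : ℕ}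
    (h1 : (T α)^[M] (α - 1) = (T α)^[N] α) (h2 : (T α)^[M'] (α - 1) = (T α)^[N'] α) :
    (M : ℤ) - N = M' - N' := by
  have hinj := T_iterate_injective h hα (abs_lt.2 ⟨by linarith [h.1], h.2⟩)
  have key : ∀ {M N M' N' : ℕ}, M ≤ M' → (T α)^[M] (α - 1) = (T α)^[N] α →
      (T α)^[M'] (α - 1) = (T α)^[N'] α → (M : ℤ) - N = M' - N' := by
    intro M N M' N' hle h1 h2
    obtain ⟨k, rfl⟩ := Nat.exists_eq_add_of_le hle
    rw [add_comm, Function.iterate_add_apply, h1, ← Function.iterate_add_apply] at h2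
    have := hinj h2
    push_cast
    lia
  rcases le_total M M' with hle | hle
  · exact key hle h1 h2
  · exact (key hle h2 h1).symm

lemma moebius_ne_zero_and_not_intCast (hα : Transcendental ℚ α) {a b c d : ℤ}
    (hdet : a * d - b * c ≠ 0) (hden1 : |(c * α + d : ℝ)| ≤ 1)
    (hx : |(a * α + b) / (c * α + d)| < 1) :
    (a * α + b) / (c * α + d) ≠ 0 ∧ ∀ n : ℤ, 1 / ((a * α + b) / (c * α + d)) + 1 - α ≠ n := by
  have hnum : a * α + b ≠ 0 := hα.linear_ne_zero hdet
  have hden : c * α + d ≠ 0 :=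
    hα.linear_ne_zero (a := c) (b := d) (c := a) (d := b) (by contrapose! hdet; linarith)
  refine ⟨div_ne_zero hnum hden, fun n hn => ?_⟩
  rw [one_div_div] at hn
  have hn' : (c * α + d) = (a * α + b) * (α + n - 1) := by
    have : (c * α + d) / (a * α + b) = α + n - 1 := by linarith
    rw [← this, mul_div_cancel₀ _ hnum]
  obtain ⟨rfl, h1, h2⟩ := hα.quadratic_eq_zero (a := a) (b := a * (n - 1) + b - c)
    (c := b * (n - 1) - d) (by push_cast; linarith)
  rw [abs_div, div_lt_one (abs_pos.2 hden)] at hx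
  have hb : |(b : ℝ)| < 1 := by simpa using hx.trans_le hden1
  have hb' : |b| < 1 := by exact_mod_cast hb
  have := Int.abs_lt_one_iff.1 hb'
  simp [this] at hdet

lemma abs_add_lt_one (h : α ∈ Ioo (0 : ℝ) 1) {e : ℤ} (he : e = 0 ∨ e = -1) : |α + e| < 1 := by
  rcases he with rfl | rfl <;> push_cast <;> rw [abs_lt] <;> constructor <;> linarith [h.1, h.2]

/-- Near a transcendental parameter, the orbits of both endpoints are Möbius functions of the
parameter. -/
lemma eventually_T_iterate_eq_moebius (h : α ∈ Ioo (0 : ℝ) 1) (hα : Transcendental ℚ α) {e : ℤ}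
    (he : e = 0 ∨ e = -1) (n : ℕ) : ∃ a b c d : ℤ, a * d - b * c ≠ 0 ∧
      |(c * α + d : ℝ)| ≤ 1 ∧
      ∀ᶠ β in 𝓝 α, (T β)^[n] (β + e) = (a * β + b) / (c * β + d) := by
  induction n with
  | zero => exact ⟨1, e, 0, 1, by simp⟩
  | succ n ih =>
    obtain ⟨a, b, c, d, hdet, hden1, hev⟩ := ih
    have hx1 := abs_T_iterate_lt_one h (abs_add_lt_one h he) n
    rw [hev.self_of_nhds] at hx1
    obtain ⟨hx0, hnotint⟩ := moebius_ne_zero_and_not_intCast hα hdet hden1 hx1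
    have hnum : a * α + b ≠ 0 := fun h => hx0 (by rw [h, zero_div])
    have hden : c * α + d ≠ 0 := fun h => hx0 (by rw [h, div_zero])
    set k := ⌊1 / ((a * α + b) / (c * α + d)) + 1 - α⌋ with hk
    have hfloor : ∀ᶠ β : ℝ in 𝓝 α, ⌊1 / ((a * β + b) / (c * β + d)) + 1 - β⌋ = k := by
      have hcont : ContinuousAt (fun β : ℝ => 1 / ((a * β + b) / (c * β + d)) + 1 - β) α := by
        fun_prop (disch := assumption)
      have hmem : Ioo (k : ℝ) (k + 1) ∈ 𝓝 (1 / ((a * α + b) / (c * α + d)) + 1 - α) :=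
        Ioo_mem_nhds (lt_of_le_of_ne (Int.floor_le _) (hnotint k).symm) (Int.lt_floor_add_one _)
      filter_upwards [hcont hmem] with β hβ
      rw [Int.floor_eq_iff]
      exact ⟨hβ.1.le, hβ.2⟩
    have hnum_ev : ∀ᶠ β : ℝ in 𝓝 α, a * β + b ≠ 0 :=
      ContinuousAt.eventually_ne (by fun_prop) hnum
    have hden_ev : ∀ᶠ β : ℝ in 𝓝 α, c * β + d ≠ 0 :=
      ContinuousAt.eventually_ne (by fun_prop) hden
    refine ⟨c - k * a, d - k * b, a, b, by contrapose! hdet; linarith, ?_, ?_⟩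
    · rw [abs_div, div_lt_one (abs_pos.2 hden)] at hx1
      exact hx1.le.trans hden1
    · filter_upwards [hev, hfloor, hnum_ev, hden_ev] with β h1 h2 h3 h4
      rw [Function.iterate_succ_apply', h1, T_of_ne_zero (div_ne_zero h3 h4), h2, one_div_div]
      push_cast
      rw [eq_div_iff h3, sub_mul, div_mul_cancel₀ _ h3]
      ring

lemma T_iterate_not_intCast (h : α ∈ Ioo (0 : ℝ) 1) (hα : Transcendental ℚ α) {e : ℤ}
    (he : e = 0 ∨ e = -1) (n : ℕ) :
    (T α)^[n] (α + e) ≠ 0 ∧ ∀ k : ℤ, 1 / (T α)^[n] (α + e) + 1 - α ≠ k := by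
  obtain ⟨a, b, c, d, hdet, hden1, hev⟩ := eventually_T_iterate_eq_moebius h hα he n
  have hx1 := abs_T_iterate_lt_one h (abs_add_lt_one h he) n
  rw [hev.self_of_nhds] at hx1 ⊢
  exact moebius_ne_zero_and_not_intCast hα hdet hden1 hx1

lemma continuousAt_T_iterate (h : α ∈ Ioo (0 : ℝ) 1) (hα : Transcendental ℚ α) {e : ℤ}
    (he : e = 0 ∨ e = -1) (n : ℕ) : ContinuousAt (fun β => (T β)^[n] (β + e)) α := by
  obtain ⟨a, b, c, d, hdet, -, hev⟩ := eventually_T_iterate_eq_moebius h hα he n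
  have hden : c * α + d ≠ 0 :=
    hα.linear_ne_zero (a := c) (b := d) (c := a) (d := b) (by contrapose! hdet; linarith)
  refine ContinuousAt.congr ?_ (EventuallyEq.symm hev)
  fun_prop (disch := assumption)

lemma eventually_matching (h : α ∈ Ioo (0 : ℝ) 1) (hα : Transcendental ℚ α) {M N : ℕ}
    (hMN : (T α)^[M] (α - 1) = (T α)^[N] α) :
    ∀ᶠ β in 𝓝 α, (T β)^[M] (β - 1) = (T β)^[N] β := by
  obtain ⟨a, b, c, d, hdet, -, hev⟩ := eventually_T_iterate_eq_moebius h hα (Or.inr rfl) M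
  obtain ⟨a', b', c', d', hdet', -, hev'⟩ := eventually_T_iterate_eq_moebius h hα (Or.inl rfl) N
  simp only [Int.cast_neg, Int.cast_one, ← sub_eq_add_neg, Int.cast_zero, add_zero] at hev hev'
  have hden : c * α + d ≠ 0 :=
    hα.linear_ne_zero (a := c) (b := d) (c := a) (d := b) (by contrapose! hdet; linarith)
  have hden' : c' * α + d' ≠ 0 :=
    hα.linear_ne_zero (a := c') (b := d') (c := a') (d := b') (by contrapose! hdet'; linarith)
  rw [hev.self_of_nhds, hev'.self_of_nhds, div_eq_div_iff hden hden'] at hMN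
  obtain ⟨h2, h1, h0⟩ := hα.quadratic_eq_zero (a := a * c' - a' * c)
    (b := a * d' + b * c' - a' * d - b' * c) (c := b * d' - b' * d) (by push_cast; linarith)
  have hden_ev : ∀ᶠ β : ℝ in 𝓝 α, c * β + d ≠ 0 := ContinuousAt.eventually_ne (by fun_prop) hden
  have hden_ev' : ∀ᶠ β : ℝ in 𝓝 α, c' * β + d' ≠ 0 :=
    ContinuousAt.eventually_ne (by fun_prop) hden'
  filter_upwards [hev, hev', hden_ev, hden_ev'] with β e1 e2 e3 e4
  rw [e1, e2, div_eq_div_iff e3 e4]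
  have h2' : (a * c' - a' * c : ℝ) = 0 := by exact_mod_cast h2
  have h1' : (a * d' + b * c' - a' * d - b' * c : ℝ) = 0 := by exact_mod_cast h1
  have h0' : (b * d' - b' * d : ℝ) = 0 := by exact_mod_cast h0
  linear_combination β ^ 2 * h2' + β * h1' + h0'

lemma eventually_not_matching (h : α ∈ Ioo (0 : ℝ) 1) (hα : Transcendental ℚ α) {M N : ℕ}
    (hMN : (T α)^[M] (α - 1) ≠ (T α)^[N] α) :
    ∀ᶠ β in 𝓝 α, (T β)^[M] (β - 1) ≠ (T β)^[N] β := by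
  have h1 := continuousAt_T_iterate h hα (Or.inr rfl) M
  have h2 := continuousAt_T_iterate h hα (Or.inl rfl) N
  simp only [Int.cast_neg, Int.cast_one, ← sub_eq_add_neg, Int.cast_zero, add_zero] at h1 h2
  exact ((h1.sub h2).eventually_ne (sub_ne_zero.2 hMN)).mono fun β hβ => sub_ne_zero.1 hβ

lemma T_one_sub_neg {x : ℝ} (hx : x ≠ 0) (h : ∀ k : ℤ, 1 / x + 1 - α ≠ k) :
    T (1 - α) (-x) = -T α x := by
  rw [T_of_ne_zero hx, T_of_ne_zero (neg_ne_zero.2 hx), one_div_neg_eq_neg_one_div]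
  have : ⌊-(1 / x) + 1 - (1 - α)⌋ = -⌊1 / x + 1 - α⌋ := by
    have h1 := Int.floor_le (1 / x + 1 - α)
    have h2 := Int.lt_floor_add_one (1 / x + 1 - α)
    have h3 := lt_of_le_of_ne h1 (h _).symm
    rw [Int.floor_eq_iff]
    push_cast
    constructor <;> linarith
  rw [this]
  push_cast
  ring

lemma T_one_sub_iterate_neg (h : α ∈ Ioo (0 : ℝ) 1) (hα : Transcendental ℚ α) {e : ℤ}
    (he : e = 0 ∨ e = -1) (n : ℕ) :
    (T (1 - α))^[n] (-(α + e)) = -(T α)^[n] (α + e) := by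
  induction n with
  | zero => rfl
  | succ n ih =>
    obtain ⟨h1, h2⟩ := T_iterate_not_intCast h hα he n
    rw [Function.iterate_succ_apply', Function.iterate_succ_apply', ih, T_one_sub_neg h1 h2]

end Transcendental

section Assembly

variable {α : ℝ}

lemma exists_minimal_matching {M N : ℕ} (hMN : (T α)^[M] (α - 1) = (T α)^[N] α)
    (h : α ∈ Ioo (0 : ℝ) 1) (hα : Transcendental ℚ α) :
    ∃ M N : ℕ, (T α)^[M] (α - 1) = (T α)^[N] α ∧
      (T α)^[M - 1] (α - 1) ≠ (T α)^[N - 1] α := by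
  have hα' : Transcendental ℚ (α - 1) := fun h => hα (by simpa using h.add isAlgebraic_one)
  have hinj := T_iterate_injective h hα (abs_lt.2 ⟨by linarith [h.1], h.2⟩)
  have hinj' := T_iterate_injective h hα' (abs_lt.2 ⟨by linarith [h.1], by linarith [h.2]⟩)
  induction M generalizing N with
  | zero =>
    refine ⟨0, N, hMN, fun heq => ?_⟩
    have := hinj (hMN.symm.trans heq)
    obtain rfl : N = 0 := by lia
    simp at hMN
  | succ M ih =>
    cases N with
    | zero =>
      refine ⟨M + 1, 0, hMN, fun heq => ?_⟩
      have := hinj' (hMN.trans heq.symm)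
      simp at this
    | succ N =>
      by_cases heq : (T α)^[M] (α - 1) = (T α)^[N] α
      · exact ih heq
      · exact ⟨M + 1, N + 1, hMN, heq⟩

/-- The defining properties of a matching interval apart from maximality. -/
def IsPreMatchingInterval (J : Set ℝ) (M N : ℕ) : Prop :=
  (∃ a b : ℝ, a < b ∧ J = Ioo a b) ∧ J ⊆ Icc 0 1 ∧
  (∀ α ∈ J, (T α)^[M] (α - 1) = (T α)^[N] α) ∧
  (∀ᵐ α ∂(volume.restrict J), (T α)^[M - 1] (α - 1) ≠ (T α)^[N - 1] α)

/-- Every interval with the matching properties is contained in a maximal one. -/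
lemma IsPreMatchingInterval.exists_maximal {J : Set ℝ} {M N : ℕ}
    (hJ : IsPreMatchingInterval J M N) : ∃ J', IsMatchingInterval J' M N ∧ J ⊆ J' := by
  set F : Set (Set ℝ) := {I | IsPreMatchingInterval I M N ∧ J ⊆ I} with hF
  have hJF : J ∈ F := ⟨hJ, subset_rfl⟩
  have hopen : ∀ I ∈ F, IsOpen I := by
    rintro I ⟨⟨⟨a, b, -, rfl⟩, -⟩, -⟩
    exact isOpen_Ioo
  obtain ⟨x, hx⟩ : J.Nonempty := by
    obtain ⟨⟨a, b, hab, rfl⟩, -⟩ := hJ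
    exact nonempty_Ioo.2 hab
  have hsub : ⋃₀ F ⊆ Icc 0 1 := sUnion_subset fun I hI => hI.1.2.1
  have hconn : IsConnected (⋃₀ F) := by
    refine ⟨⟨x, J, hJF, hx⟩, isPreconnected_sUnion x F (fun I hI => hI.2 hx) ?_⟩
    rintro I ⟨⟨⟨a, b, -, rfl⟩, -⟩, -⟩
    exact isPreconnected_Ioo
  have hbelow : BddBelow (⋃₀ F) := bddBelow_Icc.mono hsub
  have habove : BddAbove (⋃₀ F) := bddAbove_Icc.mono hsub
  have hUopen : IsOpen (⋃₀ F) := isOpen_sUnion hopen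
  have hIoo : ⋃₀ F = Ioo (sInf (⋃₀ F)) (sSup (⋃₀ F)) := by
    refine Subset.antisymm (fun y hy => ?_) (hconn.Ioo_csInf_csSup_subset hbelow habove)
    obtain ⟨l, u, hlu, hI⟩ := mem_nhds_iff_exists_Ioo_subset.1 (hUopen.mem_nhds hy)
    obtain ⟨z, hz⟩ := exists_between hlu.1
    obtain ⟨z', hz'⟩ := exists_between hlu.2
    exact ⟨(csInf_le hbelow (hI ⟨hz.1, hz.2.trans hlu.2⟩)).trans_lt hz.2,
      hz'.1.trans_le (le_csSup habove (hI ⟨hlu.1.trans hz'.1, hz'.2⟩))⟩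
  have hlt : sInf (⋃₀ F) < sSup (⋃₀ F) := by
    rw [← nonempty_Ioo, ← hIoo]
    exact hconn.nonempty
  have hae : ∀ᵐ α ∂(volume.restrict (⋃₀ F)), (T α)^[M - 1] (α - 1) ≠ (T α)^[N - 1] α := by
    obtain ⟨S, hSc, hSF, hSU⟩ := TopologicalSpace.isOpen_sUnion_countable F hopen
    rw [← hSU, sUnion_eq_biUnion, ae_restrict_biUnion_iff _ hSc]
    exact fun I hI => (hSF hI).1.2.2.2
  refine ⟨⋃₀ F, ⟨⟨_, _, hlt, hIoo⟩, hsub, ?_, hae, ?_⟩, subset_sUnion_of_mem hJF⟩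
  · rintro β ⟨I, hI, hβ⟩
    exact hI.1.2.2.1 β hβ
  · intro J' h1 h2 h3 h4 h5
    exact Subset.antisymm
      (subset_sUnion_of_mem ⟨⟨h1, h2, h3, h4⟩, (subset_sUnion_of_mem hJF).trans h5⟩) h5

lemma mem_matchingSet (h : α ∈ Ioo (0 : ℝ) 1) (hα : Transcendental ℚ α) {M N : ℕ}
    (hMN : (T α)^[M] (α - 1) = (T α)^[N] α) : α ∈ MatchingSet := by
  obtain ⟨M, N, h1, h2⟩ := exists_minimal_matching hMN h hα
  have hev := (eventually_matching h hα h1).and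
    ((eventually_not_matching h hα h2).and (Ioo_mem_nhds h.1 h.2))
  obtain ⟨l, u, hlu, hI⟩ := mem_nhds_iff_exists_Ioo_subset.1 hev
  have hpre : IsPreMatchingInterval (Ioo l u) M N := by
    refine ⟨⟨l, u, hlu.1.trans hlu.2, rfl⟩, fun β hβ => Ioo_subset_Icc_self (hI hβ).2.2,
      fun β hβ => (hI hβ).1, ?_⟩
    filter_upwards [ae_restrict_mem measurableSet_Ioo] with β hβ
    exact (hI hβ).2.1
  obtain ⟨J, hJ, hsub⟩ := hpre.exists_maximal
  exact ⟨J, M, N, hJ, hsub hlu⟩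

lemma Transcendental.hasMatching (hα : Transcendental ℚ α) (h0 : 0 < α) (h1 : α < 1 / 2)
    (hdense : ∀ c d : ℝ, 0 ≤ c → c < d → d ≤ 1 → ∃ n, gaussMap^[n] α ∈ Ioo c d) :
    HasMatching α := by
  have hne : α ^ 2 - 3 * α + 1 ≠ 0 := fun h => by
    have := (hα.quadratic_eq_zero (a := 1) (b := -3) (c := 1) (by push_cast; linarith)).1
    exact one_ne_zero this
  rcases lt_or_gt_of_ne hne with h | h
  · refine hasMatching_of_large h1 h (fun h => ?_) (fun h => ?_)
    · have := (hα.quadratic_eq_zero (a := 1) (b := 2) (c := -1) (by push_cast; linarith)).1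
      exact one_ne_zero this
    · have := (hα.quadratic_eq_zero (a := 0) (b := 5) (c := -2) (by push_cast; linarith)).2.1
      norm_num at this
  · exact hasMatching_of_dense_orbit h0 h1 h hα.irrational hdense

lemma HasMatching.reflect (h : α ∈ Ioo (0 : ℝ) 1) (hα : Transcendental ℚ α)
    (hm : HasMatching (1 - α)) :
    ∃ M N : ℕ, (T α)^[M] (α - 1) = (T α)^[N] α ∧ (M = N ∨ N = M + 2) := by
  obtain ⟨M, N, hMN, hidx⟩ := hm
  have h1 := T_one_sub_iterate_neg h hα (Or.inl rfl) M
  have h2 := T_one_sub_iterate_neg h hα (Or.inr rfl) N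
  simp only [Int.cast_neg, Int.cast_one, ← sub_eq_add_neg, Int.cast_zero, add_zero, neg_sub]
    at h1 h2
  rw [show 1 - α - 1 = -α by ring, h1, h2, neg_inj] at hMN
  exact ⟨N, M, hMN.symm, hidx.imp Eq.symm id⟩

lemma ae_matching : ∀ᵐ α : ℝ, Transcendental ℚ α ∧ α ≠ 1 / 2 ∧ (α ∈ Ioo (0 : ℝ) 1 →
    (α < 1 / 2 → ∃ M N : ℕ, (T α)^[M] (α - 1) = (T α)^[N] α ∧ (M = N ∨ M = N + 2)) ∧
    (1 / 2 < α → ∃ M N : ℕ, (T α)^[M] (α - 1) = (T α)^[N] α ∧ (M = N ∨ N = M + 2))) := by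
  have htr : ∀ᵐ α : ℝ, Transcendental ℚ α := by
    have := (Algebraic.countable ℚ ℝ).measure_zero volume
    filter_upwards [measure_eq_zero_iff_ae_notMem.1 this] with α hα
    exact hα
  have hd := ae_gaussMap_orbit_dense
  have hd' := (volume.measurePreserving_sub_left (1 : ℝ)).quasiMeasurePreserving.ae hd
  filter_upwards [htr, hd, hd'] with α hα hd hd'
  have hirr : Irrational α := hα.irrational
  refine ⟨hα, fun h => hirr ⟨1 / 2, by rw [h]; norm_num⟩, fun h => ⟨fun h1 => ?_, fun h1 => ?_⟩⟩
  · exact hα.hasMatching h.1 h1 (hd hirr h)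
  · have hα' : Transcendental ℚ (1 - α) := fun h => hα (by simpa using isAlgebraic_one.sub h)
    exact (hα'.hasMatching (by linarith [h.2]) (by linarith)
      (hd' hα'.irrational ⟨by linarith [h.2], by linarith [h.1]⟩)).reflect h hα

lemma exists_mem_of_ae_of_isOpen {p : ℝ → Prop} (hp : ∀ᵐ x : ℝ, p x) {U : Set ℝ} (hU : IsOpen U)
    (hne : U.Nonempty) : ∃ x ∈ U, p x := by
  have h := (Measure.dense_of_ae hp).inter_open_nonempty U hU hne
  exact h

end Assembly

theorem stmt9 :
    volume (Set.Icc (0 : ℝ) 1 \ MatchingSet) = 0 ∧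
    (∀ (J : Set ℝ) (M N : ℕ), IsMatchingInterval J M N →
      ((M : ℤ) - N = -2 ∨ (M : ℤ) - N = 0 ∨ (M : ℤ) - N = 2) ∧
      ((J ∩ Set.Ico (0 : ℝ) (1 / 2)).Nonempty → (M : ℤ) - N = 0 ∨ (M : ℤ) - N = 2) ∧
      ((J ∩ Set.Ioc (1 / 2 : ℝ) 1).Nonempty → (M : ℤ) - N = 0 ∨ (M : ℤ) - N = -2)) := by
  constructor
  · rw [measure_eq_zero_iff_ae_notMem]
    have h0 : ∀ᵐ x : ℝ, x ≠ 0 := Measure.ae_ne volume 0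
    have h1 : ∀ᵐ x : ℝ, x ≠ 1 := Measure.ae_ne volume 1
    filter_upwards [ae_matching, h0, h1] with α ⟨hα, hne, hm⟩ h0 h1 hmem
    have h : α ∈ Ioo (0 : ℝ) 1 :=
      ⟨lt_of_le_of_ne hmem.1.1 h0.symm, lt_of_le_of_ne hmem.1.2 h1⟩
    apply hmem.2
    rcases lt_or_gt_of_ne hne with hlt | hlt
    · obtain ⟨M, N, hMN, -⟩ := (hm h).1 hlt
      exact mem_matchingSet h hα hMN
    · obtain ⟨M, N, hMN, -⟩ := (hm h).2 hlt
      exact mem_matchingSet h hα hMN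
  · rintro J M N ⟨⟨a, b, hab, rfl⟩, hsub, hmatch, -⟩
    have h01 : 0 ≤ a ∧ b ≤ 1 := by
      rwa [← Icc_subset_Icc_iff hab.le, ← closure_Ioo hab.ne, isClosed_Icc.closure_subset_iff]
    have hlow : a < 1 / 2 → (M : ℤ) - N = 0 ∨ (M : ℤ) - N = 2 := by
      intro ha
      obtain ⟨α, hαU, hα, -, hm⟩ := exists_mem_of_ae_of_isOpen ae_matching
        (isOpen_Ioo (a := a) (b := min b (1 / 2))) (nonempty_Ioo.2 (lt_min hab ha))
      have hb := lt_min_iff.1 hαU.2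
      have h : α ∈ Ioo (0 : ℝ) 1 := ⟨h01.1.trans_lt hαU.1, hb.1.trans_le h01.2⟩
      obtain ⟨M', N', hMN, hidx⟩ := (hm h).1 hb.2
      have := matching_index_unique h hα (hmatch α ⟨hαU.1, hb.1⟩) hMN
      lia
    have hhigh : 1 / 2 < b → (M : ℤ) - N = 0 ∨ (M : ℤ) - N = -2 := by
      intro hb
      obtain ⟨α, hαU, hα, -, hm⟩ := exists_mem_of_ae_of_isOpen ae_matching
        (isOpen_Ioo (a := max a (1 / 2)) (b := b)) (nonempty_Ioo.2 (max_lt hab hb))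
      have ha := max_lt_iff.1 hαU.1
      have h : α ∈ Ioo (0 : ℝ) 1 := ⟨h01.1.trans_lt ha.1, hαU.2.trans_le h01.2⟩
      obtain ⟨M', N', hMN, hidx⟩ := (hm h).2 ha.2
      have := matching_index_unique h hα (hmatch α ⟨ha.1, hαU.2⟩) hMN
      lia
    refine ⟨?_, ?_, ?_⟩
    · rcases lt_or_ge a (1 / 2) with ha | ha
      · have := hlow ha
        lia
      · have := hhigh (ha.trans_lt hab)
        lia
    · rintro ⟨x, hx, hx'⟩
      exact hlow (hx.1.trans hx'.2)
    · rintro ⟨x, hx, hx'⟩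
      exact hhigh (hx'.1.trans hx.2)
end
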